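/- arXiv:2105.11887 — 2 statements merged into one kernel-verified Lean document; each statement's English description precedes it below -/
import Mathlib

section
/- (Cheng–Yau gradient estimate) Let G=(V,w,m,d₀) be a salami with the combinatorial distance d₀ and bounded geometry, i.e. there exist 0 < c < C such that c < m(x) < C, c < w(x,y) < C and Deg(x) < C for all adjacent x,y. Then there exists a constant C' such that for every x₀ ∈ V, every R ≥ 1, and every function u that is positive and harmonic on the ball B_R(x₀), one has |∇u|(x₀) ≤ (C'/R) · u(x₀). -/
open Filter

namespace SalamiPaper

variable {V : Type*}

/-- Locally finite: every vertex has finitely many neighbors. -/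
def LocallyFinite (w : V → V → ℝ) : Prop := ∀ x : V, {y | 0 < w x y}.Finite

/-- Connectedness of the weighted graph: any two vertices are joined by a path. -/
def GraphConnected (w : V → V → ℝ) : Prop :=
  ∀ x y : V, Relation.ReflTransGen (fun a b => 0 < w a b) x y

/-- The weighted graph Laplacian `Δf(x) = (1/m(x)) ∑_y w(x,y)(f(y)-f(x))`. -/
noncomputable def lap (w : V → V → ℝ) (m : V → ℝ) (f : V → ℝ) (x : V) : ℝ :=
  (m x)⁻¹ * ∑ᶠ y, w x y * (f y - f x)

/-- The vertex degree `Deg(x) = (1/m(x)) ∑_y w(x,y)`. -/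
noncomputable def deg (w : V → V → ℝ) (m : V → ℝ) (x : V) : ℝ :=
  (m x)⁻¹ * ∑ᶠ y, w x y

/-- The set of `d`-lengths of adjacency paths from `x` to `y`. -/
def pathLens (w : V → V → ℝ) (d : V → V → ℝ) (x y : V) : Set ℝ :=
  {L | ∃ (n : ℕ) (p : ℕ → V), p 0 = x ∧ p n = y ∧
    (∀ i < n, 0 < w (p i) (p (i + 1))) ∧
    L = ∑ i ∈ Finset.range n, d (p i) (p (i + 1))}

/-- `d` is a path metric on the graph with edge weight `w`. -/
def IsPathMetric (w : V → V → ℝ) (d : V → V → ℝ) : Prop :=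
  (∀ x, d x x = 0) ∧ (∀ x y, x ≠ y → 0 < d x y) ∧ (∀ x y, d x y = d y x) ∧
  (∀ x y z, d x z ≤ d x y + d y z) ∧
  (∀ x y, d x y = sInf (pathLens w d x y))

/-- All balls are finite. -/
def FiniteBalls (d : V → V → ℝ) : Prop := ∀ (x : V) (R : ℝ), {y | d x y ≤ R}.Finite

/-- The combinatorial graph distance (as a real number). -/
noncomputable def combDist (w : V → V → ℝ) (x y : V) : ℝ :=
  sInf {L | ∃ (n : ℕ) (p : ℕ → V), p 0 = x ∧ p n = y ∧
    (∀ i < n, 0 < w (p i) (p (i + 1))) ∧ L = (n : ℝ)}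

/-- `Lip(1)`: the 1-Lipschitz functions with respect to `d`. -/
def Lip1 (d : V → V → ℝ) (f : V → ℝ) : Prop := ∀ x y, f y - f x ≤ d x y

/-- The Ollivier curvature
`κ(x,y) = (1/d(x,y)) inf{Δf(x) - Δf(y) : f ∈ Lip(1), f(y)-f(x) = d(x,y)}`. -/
noncomputable def kappa (w : V → V → ℝ) (m : V → ℝ) (d : V → V → ℝ) (x y : V) : ℝ :=
  (d x y)⁻¹ * sInf {c | ∃ f : V → ℝ, Lip1 d f ∧ f y - f x = d x y ∧
    c = lap w m f x - lap w m f y}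

/-- `m(A) = ∞`: the total measure of `A` is infinite. -/
def InfVolume (m : V → ℝ) (A : Set V) : Prop :=
  ∀ c : ℝ, ∃ F : Finset V, ↑F ⊆ A ∧ c < ∑ x ∈ F, m x

/-- A salami partition `(X,Y,K)`. -/
def SalamiPartition (w : V → V → ℝ) (m : V → ℝ) (X Y K : Set V) : Prop :=
  X ∪ Y ∪ K = Set.univ ∧ Disjoint X Y ∧ Disjoint X K ∧ Disjoint Y K ∧
  K.Finite ∧ (∀ x ∈ X, ∀ y ∈ Y, w x y = 0) ∧ InfVolume m X ∧ InfVolume m Y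

/-- Reachability inside a subset `A` of the vertex set. -/
def reachIn (w : V → V → ℝ) (A : Set V) : V → V → Prop :=
  Relation.ReflTransGen (fun a b => a ∈ A ∧ b ∈ A ∧ 0 < w a b)

/-- The induced subgraph on `A` is connected. -/
def ConnectedIn (w : V → V → ℝ) (A : Set V) : Prop :=
  ∀ x ∈ A, ∀ y ∈ A, reachIn w A x y

/-- A connected salami partition: `K` induces a connected subgraph. -/
def ConnectedSalamiPartition (w : V → V → ℝ) (m : V → ℝ) (X Y K : Set V) : Prop :=
  SalamiPartition w m X Y K ∧ ConnectedIn w K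

/-- The basic standing assumptions on a weighted graph `G = (V,w,m,d)`:
countable vertex set, symmetric non-negative edge weight vanishing on the diagonal,
positive vertex measure, local finiteness, connectedness,
`d` a path metric with finite balls. -/
def IsGraphBase (w : V → V → ℝ) (m : V → ℝ) (d : V → V → ℝ) : Prop :=
  Countable V ∧ (∀ x y, w x y = w y x) ∧ (∀ x y, 0 ≤ w x y) ∧ (∀ x, w x x = 0) ∧
  (∀ x, 0 < m x) ∧ LocallyFinite w ∧ GraphConnected w ∧
  IsPathMetric w d ∧ FiniteBalls d

/-- Non-negative Ollivier curvature on all edges. -/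
def NonnegCurv (w : V → V → ℝ) (m : V → ℝ) (d : V → V → ℝ) : Prop :=
  ∀ x y, 0 < w x y → 0 ≤ kappa w m d x y

/-- A salami: a connected, locally finite weighted graph with a path metric with
finite balls, non-negative Ollivier curvature, admitting a salami partition. -/
def IsSalami (w : V → V → ℝ) (m : V → ℝ) (d : V → V → ℝ) : Prop :=
  IsGraphBase w m d ∧ NonnegCurv w m d ∧ ∃ X Y K : Set V, SalamiPartition w m X Y K

/-- `G` has at least `n` ends: there is a finite set `K` such that `V ∖ K` has at
least `n` infinite connected components. -/
def atLeastEnds (w : V → V → ℝ) (n : ℕ) : Prop :=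
  ∃ K : Set V, K.Finite ∧ ∃ x : Fin n → V,
    (∀ i, x i ∉ K) ∧ (∀ i, {y | reachIn w Kᶜ (x i) y}.Infinite) ∧
    (∀ i j, i ≠ j → ¬ reachIn w Kᶜ (x i) (x j))

/-- `Lip(1,K)`: functions that are 1-Lipschitz on `K`. -/
def Lip1On (d : V → V → ℝ) (K : Set V) (f : V → ℝ) : Prop :=
  ∀ x ∈ K, ∀ y ∈ K, f y - f x ≤ d x y

open Classical in
/-- The extremal Lipschitz extension operator `S(P)` of the salami partition
`P = (X,Y,K)`. -/
noncomputable def Sop (d : V → V → ℝ) (X Y K : Set V) (f : V → ℝ) : V → ℝ :=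
  fun v =>
    if v ∈ K then f v
    else if v ∈ X then sSup {c | ∃ u ∈ K, c = f u - d v u}
    else sInf {c | ∃ u ∈ K, c = f u + d v u}

/-- `ℱ(P) = S(P)(Lip(1,K))`. -/
def calF (d : V → V → ℝ) (X Y K : Set V) : Set (V → ℝ) :=
  {g | ∃ f : V → ℝ, Lip1On d K f ∧ g = Sop d X Y K f}

/-- `ℋ(P)`: the harmonic functions in `ℱ(P)`. -/
def calH (w : V → V → ℝ) (m : V → ℝ) (d : V → V → ℝ) (X Y K : Set V) :
    Set (V → ℝ) :=
  {g | g ∈ calF d X Y K ∧ ∀ x, lap w m g x = 0}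

/-- `∇₊f(x) = max_{y∼x} (f(y)-f(x))/d(x,y)`. -/
noncomputable def gradPlus (w : V → V → ℝ) (d : V → V → ℝ) (f : V → ℝ) (x : V) : ℝ :=
  sSup {c | ∃ y, 0 < w x y ∧ c = (f y - f x) / d x y}

/-- `∇₋f(x) = max_{y∼x} (f(x)-f(y))/d(x,y)`. -/
noncomputable def gradMinus (w : V → V → ℝ) (d : V → V → ℝ) (f : V → ℝ) (x : V) : ℝ :=
  sSup {c | ∃ y, 0 < w x y ∧ c = (f x - f y) / d x y}

/-- `|∇f|(x) = max_{y∼x} |f(y)-f(x)|/d(x,y)`. -/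
noncomputable def gradAbs (w : V → V → ℝ) (d : V → V → ℝ) (f : V → ℝ) (x : V) : ℝ :=
  sSup {c | ∃ y, 0 < w x y ∧ c = |f y - f x| / d x y}

/-- Recurrence: for every `ε > 0` there is a finitely supported `f` with
`‖f‖∞ = 1` and `-⟨f, Δf⟩ < ε`. -/
def Recurrent (w : V → V → ℝ) (m : V → ℝ) : Prop :=
  ∀ ε : ℝ, 0 < ε → ∃ f : V → ℝ, (Function.support f).Finite ∧
    (∀ x, |f x| ≤ 1) ∧ (∃ x, |f x| = 1) ∧
    -(∑ᶠ x, f x * lap w m f x * m x) < ε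

open Classical in
/-- `∑_{x,y : f(y) < 0 ≤ f(x)} w(x,y)(f(x)-f(y))`. -/
noncomputable def cutSum (w : V → V → ℝ) (f : V → ℝ) : ℝ :=
  ∑ᶠ p : V × V, if f p.2 < 0 ∧ 0 ≤ f p.1 then w p.1 p.2 * (f p.1 - f p.2) else 0

/-- Subexponential growth: `max_{B_r(x)} |u| = e^{o(r)}` as `r → ∞`. -/
def SubexpGrowth (d : V → V → ℝ) (x : V) (u : V → ℝ) : Prop :=
  Filter.Tendsto
    (fun r : ℕ => Real.log (sSup {c | ∃ y, d x y ≤ (r : ℝ) ∧ c = |u y|}) / (r : ℝ))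
    Filter.atTop (nhds 0)


/-- Bounded geometry of a connected weighted graph with its combinatorial distance. -/
structure BoundedGeometry (w : V → V → ℝ) (m : V → ℝ) (c C : ℝ) : Prop where
  symm : ∀ x y, w x y = w y x
  nonneg : ∀ x y, 0 ≤ w x y
  diag : ∀ x, w x x = 0
  locFin : LocallyFinite w
  conn : GraphConnected w
  metric : IsPathMetric w (combDist w)
  balls : FiniteBalls (combDist w)
  c_pos : 0 < c
  c_lt_m : ∀ x, c < m x
  m_lt_C : ∀ x, m x < C
  c_lt_w : ∀ x y, 0 < w x y → c < w x y
  deg_lt : ∀ x, deg w m x < C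

lemma combDist_le_of_path {w : V → V → ℝ} (n : ℕ) (p : ℕ → V)
    (hp : ∀ i < n, 0 < w (p i) (p (i + 1))) : combDist w (p 0) (p n) ≤ n := by
  refine csInf_le ⟨0, ?_⟩ ⟨n, p, rfl, rfl, hp, rfl⟩
  rintro _ ⟨k, _, _, _, _, rfl⟩
  positivity

lemma combDist_le_one {w : V → V → ℝ} {x y : V} (h : 0 < w x y) : combDist w x y ≤ 1 := by
  have := combDist_le_of_path (w := w) 1 (fun i => if i = 0 then x else y) (by
    intro i hi
    obtain rfl : i = 0 := by omega
    simpa using h)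
  simpa using this

lemma exists_path {w : V → V → ℝ} (hconn : GraphConnected w) (x y : V) :
    ∃ (n : ℕ) (p : ℕ → V), p 0 = x ∧ p n = y ∧ ∀ i < n, 0 < w (p i) (p (i + 1)) := by
  induction hconn x y using Relation.ReflTransGen.head_induction_on with
  | refl => exact ⟨0, fun _ => y, rfl, rfl, by simp⟩
  | @head a b hab _ ih =>
    obtain ⟨n, p, h0, hn, hp⟩ := ih
    refine ⟨n + 1, fun i => Nat.casesOn i a p, rfl, hn, ?_⟩
    rintro (_ | i) hi
    · simpa [h0] using hab
    · exact hp i (by omega)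

lemma exists_geodesic {w : V → V → ℝ} (hconn : GraphConnected w)
    (hd : IsPathMetric w (combDist w)) (x y : V) :
    ∃ (n : ℕ) (p : ℕ → V), p 0 = x ∧ p n = y ∧ (∀ i < n, 0 < w (p i) (p (i + 1))) ∧
      combDist w x y = n ∧ ∀ i ≤ n, combDist w x (p i) = i := by
  classical
  have hex : ∃ (n : ℕ), ∃ (p : ℕ → V), p 0 = x ∧ p n = y ∧
      ∀ i < n, 0 < w (p i) (p (i + 1)) := exists_path hconn x y
  obtain ⟨p, h0, hn, hp⟩ := Nat.find_spec hex
  set n := Nat.find hex with hndef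
  have hdist : combDist w x y = n := by
    apply le_antisymm
    · have := combDist_le_of_path n p hp
      rwa [h0, hn] at this
    · refine le_csInf ⟨n, n, p, h0, hn, hp, rfl⟩ ?_
      rintro _ ⟨k, q, hq0, hqk, hq, rfl⟩
      exact_mod_cast Nat.find_min' hex ⟨q, hq0, hqk, hq⟩
  refine ⟨n, p, h0, hn, hp, hdist, fun i hi => le_antisymm ?_ ?_⟩
  · have := combDist_le_of_path i p (fun j hj => hp j (by omega))
    rwa [h0] at this
  · have h1 := combDist_le_of_path (w := w) (n - i) (fun j => p (i + j)) (fun j hj => by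
      have := hp (i + j) (by omega)
      rwa [add_assoc] at this)
    simp only [add_zero, Nat.add_sub_cancel' hi, hn, Nat.cast_sub hi] at h1
    have h2 := hd.2.2.2.1 x (p i) y
    linarith

lemma lip1_of_edges {w : V → V → ℝ} (hconn : GraphConnected w)
    (hd : IsPathMetric w (combDist w)) {f : V → ℝ}
    (hf : ∀ x y, 0 < w x y → f y - f x ≤ 1) : Lip1 (combDist w) f := by
  intro x y
  obtain ⟨n, p, rfl, rfl, hp, hdist, -⟩ := exists_geodesic hconn hd x y
  rw [hdist]
  clear hdist
  induction n with
  | zero => simp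
  | succ n ih =>
    have h1 := ih (fun i hi => hp i (by omega))
    have h2 := hf _ _ (hp n (by omega))
    push_cast
    linarith

lemma sum_sum_antisymm {w : V → V → ℝ} (hw : ∀ x y, w x y = w y x) (B : Finset V)
    (f : V → ℝ) : ∑ x ∈ B, ∑ y ∈ B, w x y * (f y - f x) = 0 := by
  have h : ∑ x ∈ B, ∑ y ∈ B, w x y * (f y - f x) =
      -∑ x ∈ B, ∑ y ∈ B, w x y * (f y - f x) := by
    conv_lhs => rw [Finset.sum_comm]
    rw [← Finset.sum_neg_distrib]
    refine Finset.sum_congr rfl fun x _ => ?_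
    rw [← Finset.sum_neg_distrib]
    refine Finset.sum_congr rfl fun y _ => ?_
    rw [hw y x]
    ring
  linarith

/-- Green's formula on a finite set. -/
lemma sum_sum_gradient_eq_zero {w : V → V → ℝ} (hw : ∀ x y, w x y = w y x) (B : Finset V)
    (u v : V → ℝ) (h : ∀ x ∈ B, v x * ∑ y ∈ B, w x y * (u y - u x) = 0) :
    ∑ x ∈ B, ∑ y ∈ B, w x y * ((u y - u x) * (v x - v y)) = 0 := by
  have h1 : ∑ x ∈ B, ∑ y ∈ B, w x y * (u y - u x) * v x = 0 := by
    refine Finset.sum_eq_zero fun x hx => ?_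
    rw [← Finset.sum_mul, mul_comm]
    exact h x hx
  have h2 : ∑ x ∈ B, ∑ y ∈ B, w x y * (u y - u x) * v y = 0 := by
    rw [Finset.sum_comm, ← neg_eq_zero, ← h1, ← Finset.sum_neg_distrib]
    refine Finset.sum_congr rfl fun x _ => ?_
    rw [← Finset.sum_neg_distrib]
    refine Finset.sum_congr rfl fun y _ => ?_
    rw [hw y x]
    ring
  calc _ = ∑ x ∈ B, ∑ y ∈ B, (w x y * (u y - u x) * v x - w x y * (u y - u x) * v y) :=
        Finset.sum_congr rfl fun x _ => Finset.sum_congr rfl fun y _ => by ring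
    _ = 0 := by simp only [Finset.sum_sub_distrib, h1, h2, sub_zero]

lemma le_mul_exp_of_sq_sub_le {a b q : ℝ} (ha : 0 < a) (hb : 0 < b) (hq : 0 ≤ q)
    (h : (b - a) ^ 2 ≤ q * (a * b)) : b ≤ a * Real.exp (2 * √q) := by
  obtain ⟨α, hα, rfl⟩ : ∃ α, 0 < α ∧ α ^ 2 = a := ⟨√a, Real.sqrt_pos.2 ha, Real.sq_sqrt ha.le⟩
  obtain ⟨β, hβ, rfl⟩ : ∃ β, 0 < β ∧ β ^ 2 = b := ⟨√b, Real.sqrt_pos.2 hb, Real.sq_sqrt hb.le⟩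
  obtain ⟨r, hr, rfl⟩ : ∃ r, 0 ≤ r ∧ r ^ 2 = q := ⟨√q, Real.sqrt_nonneg q, Real.sq_sqrt hq⟩
  rw [Real.sqrt_sq hr]
  have h1 : β ^ 2 - α ^ 2 ≤ r * α * β := by
    refine abs_le_of_sq_le_sq' (b := r * α * β) ?_ (by positivity) |>.2
    linarith [show (r * α * β) ^ 2 = r ^ 2 * (α ^ 2 * β ^ 2) by ring]
  have h2 : β ≤ α * (1 + r) := by
    by_contra! hlt
    have h3 : α * r < β - α := by linarith
    have h4 : α * r * (β + α) < (β - α) * (β + α) :=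
      mul_lt_mul_of_pos_right h3 (by positivity)
    nlinarith [mul_nonneg (mul_nonneg hα.le hr) hα.le]
  have h3 : 1 + r ≤ Real.exp r := by linarith [Real.add_one_le_exp r]
  calc β ^ 2 ≤ (α * (1 + r)) ^ 2 := by gcongr
    _ ≤ (α * Real.exp r) ^ 2 := by gcongr
    _ = α ^ 2 * Real.exp (2 * r) := by rw [mul_pow, ← Real.exp_nat_mul]; norm_num

namespace BoundedGeometry

variable {w : V → V → ℝ} {m : V → ℝ} {c C : ℝ}

lemma m_pos (G : BoundedGeometry w m c C) (x : V) : 0 < m x := G.c_pos.trans (G.c_lt_m x)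

lemma C_pos (G : BoundedGeometry w m c C) (x : V) : 0 < C := (G.m_pos x).trans (G.m_lt_C x)

lemma eq_zero_of_not_pos (G : BoundedGeometry w m c C) {x y : V} (h : ¬ 0 < w x y) :
    w x y = 0 := le_antisymm (not_lt.1 h) (G.nonneg x y)

lemma mul_lap_eq_sum (G : BoundedGeometry w m c C) (f : V → ℝ) (x : V) (B : Finset V)
    (hB : ∀ y, 0 < w x y → y ∈ B) :
    m x * lap w m f x = ∑ y ∈ B, w x y * (f y - f x) := by
  rw [lap, mul_inv_cancel_left₀ (G.m_pos x).ne']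
  refine finsum_eq_sum_of_support_subset _ fun y hy => hB y ?_
  by_contra h
  exact hy (by simp [G.eq_zero_of_not_pos h])

lemma mul_deg_eq_sum (G : BoundedGeometry w m c C) (x : V) (B : Finset V)
    (hB : ∀ y, 0 < w x y → y ∈ B) : m x * deg w m x = ∑ y ∈ B, w x y := by
  rw [deg, mul_inv_cancel_left₀ (G.m_pos x).ne']
  refine finsum_eq_sum_of_support_subset _ fun y hy => hB y ?_
  by_contra h
  exact hy (by simp [G.eq_zero_of_not_pos h])

lemma sum_weight_le (G : BoundedGeometry w m c C) (x : V) (B : Finset V) :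
    ∑ y ∈ B, w x y ≤ C ^ 2 := by
  classical
  calc ∑ y ∈ B, w x y ≤ ∑ y ∈ B ∪ (G.locFin x).toFinset, w x y :=
        Finset.sum_le_sum_of_subset_of_nonneg Finset.subset_union_left
          fun y _ _ => G.nonneg x y
    _ = m x * deg w m x := by
        rw [G.mul_deg_eq_sum x]
        intro y hy
        simp [hy]
    _ ≤ m x * C := by gcongr; exacts [(G.m_pos x).le, (G.deg_lt x).le]
    _ ≤ C ^ 2 := by
        rw [sq]
        gcongr
        exacts [(G.C_pos x).le, (G.m_lt_C x).le]

lemma dist_self (G : BoundedGeometry w m c C) (x : V) : combDist w x x = 0 := G.metric.1 x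

lemma dist_comm (G : BoundedGeometry w m c C) (x y : V) : combDist w x y = combDist w y x :=
  G.metric.2.2.1 x y

lemma dist_triangle (G : BoundedGeometry w m c C) (x y z : V) :
    combDist w x z ≤ combDist w x y + combDist w y z := G.metric.2.2.2.1 x y z

lemma abs_dist_sub_le_one (G : BoundedGeometry w m c C) (x₀ : V) {x y : V} (h : 0 < w x y) :
    |combDist w x₀ x - combDist w x₀ y| ≤ 1 := by
  have h1 := combDist_le_one h
  have h2 := G.dist_triangle x₀ x y
  have h3 := G.dist_triangle x₀ y x
  rw [G.dist_comm y x] at h3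
  exact abs_le.2 ⟨by linarith, by linarith⟩

lemma dist_eq_one (G : BoundedGeometry w m c C) {x y : V} (h : 0 < w x y) :
    combDist w x y = 1 := by
  have hxy : x ≠ y := by
    rintro rfl
    exact h.ne' (G.diag x)
  refine le_antisymm (combDist_le_one h) ?_
  obtain ⟨n, -, -, -, -, hn, -⟩ := exists_geodesic G.conn G.metric x y
  have := G.metric.2.1 x y hxy
  rw [hn] at this ⊢
  exact_mod_cast this

/-- The weighted Dirichlet energy of `log u` on the smaller ball is controlled by the
total weight of the larger ball. -/
lemma sum_log_energy_le (G : BoundedGeometry w m c C) {x₀ : V} {k : ℕ} {u : V → ℝ}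
    {B B' : Finset V} (hB : ∀ y, y ∈ B ↔ combDist w x₀ y ≤ 2 * k)
    (hB' : ∀ y, y ∈ B' ↔ combDist w x₀ y ≤ k)
    (hpos : ∀ y ∈ B, 0 < u y) (hharm : ∀ y ∈ B, lap w m u y = 0) :
    (k : ℝ) ^ 2 * ∑ x ∈ B', ∑ y ∈ B', w x y * ((u y - u x) ^ 2 / (u x * u y)) ≤
      ∑ x ∈ B, ∑ y ∈ B, w x y := by
  classical
  set φ : V → ℝ := fun x => min (k : ℝ) (max 0 (2 * k - combDist w x₀ x)) with hφ
  have hφlip : ∀ x y, 0 < w x y → |φ x - φ y| ≤ 1 := by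
    intro x y h
    have h1 := G.abs_dist_sub_le_one x₀ h
    calc |φ x - φ y| ≤ |max 0 (2 * k - combDist w x₀ x) - max 0 (2 * k - combDist w x₀ y)| := by
          have := abs_min_sub_min_le_max (k : ℝ) (max 0 (2 * k - combDist w x₀ x)) k
            (max 0 (2 * k - combDist w x₀ y))
          simpa [hφ] using this
      _ ≤ |(2 * k - combDist w x₀ x) - (2 * k - combDist w x₀ y)| := by
          have := abs_max_sub_max_le_max (0 : ℝ) (2 * k - combDist w x₀ x) 0
            (2 * k - combDist w x₀ y)
          simpa using this
      _ ≤ 1 := by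
          rw [abs_sub_comm] at h1
          convert h1 using 2
          ring
  have hsub : B' ⊆ B := fun y hy => by
    rw [hB'] at hy
    rw [hB]
    have : (0 : ℝ) ≤ k := by positivity
    linarith
  have hgreen := sum_sum_gradient_eq_zero G.symm B u (fun x => φ x ^ 2 / u x) (by
    intro x hx
    by_cases hd : combDist w x₀ x + 1 ≤ 2 * k
    · rw [← G.mul_lap_eq_sum u x B, hharm x hx, mul_zero, mul_zero]
      intro y hy
      rw [hB]
      linarith [(abs_le.1 (G.abs_dist_sub_le_one x₀ hy)).1]
    · have : φ x = 0 := by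
        obtain ⟨n, -, -, -, -, hn, -⟩ := exists_geodesic G.conn G.metric x₀ x
        rw [hn] at hd
        have h2 : 2 * k ≤ n := by
          have : ¬ (n + 1 ≤ 2 * k) := by exact_mod_cast hd
          omega
        have h2' : (2 * k : ℝ) ≤ n := by exact_mod_cast h2
        simp only [hφ, hn]
        rw [max_eq_left (by linarith), min_eq_right (by positivity)]
      simp [this])
  have hpt : ∀ x ∈ B, ∀ y ∈ B,
      (if x ∈ B' ∧ y ∈ B' then (k : ℝ) ^ 2 * (w x y * ((u y - u x) ^ 2 / (u x * u y))) else 0) ≤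
      w x y + w x y * ((u y - u x) * (φ x ^ 2 / u x - φ y ^ 2 / u y)) := by
    intro x hx y hy
    by_cases hw : 0 < w x y
    swap
    · simp [G.eq_zero_of_not_pos hw]
    have ha := hpos x hx
    have hb := hpos y hy
    split_ifs with h
    · have hφk : ∀ z ∈ B', φ z = k := by
        intro z hz
        rw [hB'] at hz
        simp only [hφ]
        exact min_eq_left (le_max_of_le_right (by linarith))
      rw [hφk x h.1, hφk y h.2]
      have : (u y - u x) * ((k : ℝ) ^ 2 / u x - k ^ 2 / u y) =
          k ^ 2 * ((u y - u x) ^ 2 / (u x * u y)) := by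
        field_simp
      rw [this]
      nlinarith
    · have h1 := hφlip x y hw
      have h2 : (φ x - φ y) ^ 2 ≤ 1 := by
        rw [← sq_abs]
        exact pow_le_one₀ (abs_nonneg _) h1
      have h3 : (u y - u x) * (φ x ^ 2 / u x - φ y ^ 2 / u y) =
          (φ x * u y - φ y * u x) ^ 2 / (u x * u y) - (φ x - φ y) ^ 2 := by
        field_simp
        ring
      rw [h3]
      have h4 : 0 ≤ (φ x * u y - φ y * u x) ^ 2 / (u x * u y) := by positivity
      nlinarith
  calc (k : ℝ) ^ 2 * ∑ x ∈ B', ∑ y ∈ B', w x y * ((u y - u x) ^ 2 / (u x * u y))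
      = ∑ x ∈ B, ∑ y ∈ B, (if x ∈ B' ∧ y ∈ B' then
          (k : ℝ) ^ 2 * (w x y * ((u y - u x) ^ 2 / (u x * u y))) else 0) := by
        rw [Finset.mul_sum, ← Finset.sum_filter_add_sum_filter_not B (· ∈ B')]
        rw [Finset.filter_mem_eq_inter, Finset.inter_eq_right.2 hsub]
        rw [Finset.sum_eq_zero (s := B.filter (· ∉ B')), add_zero]
        · refine Finset.sum_congr rfl fun x hx => ?_
          simp only [hx, true_and]
          rw [← Finset.sum_filter, Finset.filter_mem_eq_inter, Finset.inter_eq_right.2 hsub,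
            Finset.mul_sum]
        · intro x hx
          simp [(Finset.mem_filter.1 hx).2]
    _ ≤ ∑ x ∈ B, ∑ y ∈ B,
          (w x y + w x y * ((u y - u x) * (φ x ^ 2 / u x - φ y ^ 2 / u y))) :=
        Finset.sum_le_sum fun x hx => Finset.sum_le_sum fun y hy => hpt x hx y hy
    _ = ∑ x ∈ B, ∑ y ∈ B, w x y := by
        simp only [Finset.sum_add_distrib]
        rw [hgreen, add_zero]

/-- Harnack inequality from a bound on the energy of `log u`. -/
lemma le_mul_exp_of_log_energy (G : BoundedGeometry w m c C) {x₀ : V} {k : ℕ} {u : V → ℝ}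
    {B' : Finset V} (hB' : ∀ y, y ∈ B' ↔ combDist w x₀ y ≤ k) (hpos : ∀ y ∈ B', 0 < u y)
    {W : ℝ}
    (hW : k * ∑ x ∈ B', ∑ y ∈ B', w x y * ((u y - u x) ^ 2 / (u x * u y)) ≤ W) :
    ∀ y ∈ B', u y ≤ u x₀ * Real.exp (2 * √(W / c)) := by
  intro y hy
  obtain ⟨n, p, h0, hn, hp, hdist, hpd⟩ := exists_geodesic G.conn G.metric x₀ y
  have hnk : n ≤ k := by
    rw [hB', hdist] at hy
    exact_mod_cast hy
  have hpB : ∀ i ≤ n, p i ∈ B' := fun i hi => by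
    rw [hB', hpd i hi]
    exact_mod_cast hi.trans hnk
  set q : V → V → ℝ := fun x y => (u y - u x) ^ 2 / (u x * u y) with hq
  have hq0 : ∀ x ∈ B', ∀ y ∈ B', 0 ≤ q x y := fun x hx y hy =>
    div_nonneg (sq_nonneg _) (mul_pos (hpos x hx) (hpos y hy)).le
  have hstep : ∀ j ≤ n, u (p j) ≤ u x₀ *
      Real.exp (2 * ∑ i ∈ Finset.range j, √(q (p i) (p (i + 1)))) := by
    intro j
    induction j with
    | zero => simp [h0]
    | succ j ih =>
      intro hj
      have ha := hpos _ (hpB j (by omega))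
      have hb := hpos _ (hpB (j + 1) hj)
      have h1 := le_mul_exp_of_sq_sub_le ha hb
        (hq0 _ (hpB j (by omega)) _ (hpB (j + 1) hj)) (by simp only [hq]; field_simp; rfl)
      calc u (p (j + 1)) ≤ u (p j) * Real.exp (2 * √(q (p j) (p (j + 1)))) := h1
        _ ≤ (u x₀ * Real.exp (2 * ∑ i ∈ Finset.range j, √(q (p i) (p (i + 1))))) *
            Real.exp (2 * √(q (p j) (p (j + 1)))) := by
            gcongr
            exact ih (by omega)
        _ = _ := by rw [Finset.sum_range_succ, mul_assoc, ← Real.exp_add, mul_add]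
  have hsumq : c * ∑ i ∈ Finset.range n, q (p i) (p (i + 1)) ≤
      ∑ x ∈ B', ∑ y ∈ B', w x y * q x y := by
    classical
    have hnonneg : ∀ x ∈ B', ∀ y ∈ B', 0 ≤ w x y * q x y := fun x hx y hy =>
      mul_nonneg (G.nonneg x y) (hq0 x hx y hy)
    have hinj : Set.InjOn p (Finset.range n : Set ℕ) := by
      intro i hi j hj hij
      simp only [Finset.coe_range, Set.mem_Iio] at hi hj
      have h1 := hpd i hi.le
      rw [hij, hpd j hj.le] at h1
      exact_mod_cast h1.symm
    calc c * ∑ i ∈ Finset.range n, q (p i) (p (i + 1))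
        ≤ ∑ i ∈ Finset.range n, ∑ y ∈ B', w (p i) y * q (p i) y := by
          rw [Finset.mul_sum]
          refine Finset.sum_le_sum fun i hi => ?_
          have hi := Finset.mem_range.1 hi
          calc c * q (p i) (p (i + 1)) ≤ w (p i) (p (i + 1)) * q (p i) (p (i + 1)) := by
                gcongr
                · exact hq0 _ (hpB i hi.le) _ (hpB _ hi)
                · exact (G.c_lt_w _ _ (hp i hi)).le
            _ ≤ _ := Finset.single_le_sum (f := fun y => w (p i) y * q (p i) y)
                (fun y hy => hnonneg _ (hpB i hi.le) y hy) (hpB _ hi)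
      _ = ∑ x ∈ (Finset.range n).image p, ∑ y ∈ B', w x y * q x y := by
          rw [Finset.sum_image hinj]
      _ ≤ _ := by
          refine Finset.sum_le_sum_of_subset_of_nonneg ?_ fun x hx _ =>
            Finset.sum_nonneg fun y hy => hnonneg x hx y hy
          intro x hx
          obtain ⟨i, hi, rfl⟩ := Finset.mem_image.1 hx
          exact hpB i (Finset.mem_range.1 hi).le
  have hsqrt : ∑ i ∈ Finset.range n, √(q (p i) (p (i + 1))) ≤ √(W / c) := by
    refine Real.le_sqrt_of_sq_le ?_
    rw [le_div_iff₀ G.c_pos]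
    calc (∑ i ∈ Finset.range n, √(q (p i) (p (i + 1)))) ^ 2 * c
        ≤ (n * ∑ i ∈ Finset.range n, √(q (p i) (p (i + 1))) ^ 2) * c := by
          gcongr
          · exact G.c_pos.le
          · simpa using sq_sum_le_card_mul_sum_sq (s := Finset.range n)
              (f := fun i => √(q (p i) (p (i + 1))))
      _ = n * (c * ∑ i ∈ Finset.range n, q (p i) (p (i + 1))) := by
          rw [Finset.sum_congr rfl fun i hi => Real.sq_sqrt
            (hq0 _ (hpB i (Finset.mem_range.1 hi).le) _ (hpB _ (Finset.mem_range.1 hi)))]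
          ring
      _ ≤ k * ∑ x ∈ B', ∑ y ∈ B', w x y * q x y := by
          gcongr
          exact mul_nonneg G.c_pos.le (Finset.sum_nonneg fun i hi => hq0 _
            (hpB i (Finset.mem_range.1 hi).le) _ (hpB _ (Finset.mem_range.1 hi)))
      _ ≤ W := hW
  have h2 := hstep n le_rfl
  rw [hn] at h2
  refine h2.trans ?_
  have : 0 < u x₀ := hpos x₀ (by rw [hB', G.dist_self]; positivity)
  gcongr

/-- The current through an edge at the centre is bounded by the mean total current. -/
lemma mul_current_le (G : BoundedGeometry w m c C) {x₀ y₀ : V} (hxy : 0 < w x₀ y₀) {k : ℕ}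
    (hk : 1 ≤ k) {u : V → ℝ} {B' : Finset V} (hB' : ∀ y, y ∈ B' ↔ combDist w x₀ y ≤ k)
    (hharm : ∀ y ∈ B', lap w m u y = 0) :
    k * (w x₀ y₀ * |u y₀ - u x₀|) ≤ ∑ x ∈ B', ∑ y ∈ B', w x y * |u y - u x| := by
  classical
  set φ : V → ℝ := fun x => max 0 (k - combDist w x₀ x) with hφ
  set ψ : V → ℝ := fun x => if max (u x₀) (u y₀) ≤ u x then 1 else 0 with hψ
  have hφlip : ∀ x y, 0 < w x y → |φ x - φ y| ≤ 1 := by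
    intro x y h
    have h1 := G.abs_dist_sub_le_one x₀ h
    calc |φ x - φ y| ≤ |(k - combDist w x₀ x) - (k - combDist w x₀ y)| := by
          have := abs_max_sub_max_le_max (0 : ℝ) (k - combDist w x₀ x) 0
            (k - combDist w x₀ y)
          simpa using this
      _ ≤ 1 := by
          rw [abs_sub_comm] at h1
          convert h1 using 2
          ring
  have hφ0 : ∀ x, 0 ≤ φ x := fun x => le_max_left _ _
  have hx₀ : x₀ ∈ B' := by rw [hB', G.dist_self]; positivity
  have hy₀ : y₀ ∈ B' := by
    rw [hB']
    have : (1 : ℝ) ≤ k := by exact_mod_cast hk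
    linarith [combDist_le_one hxy]
  have hgreen := sum_sum_gradient_eq_zero G.symm B' u (fun x => φ x * ψ x) (by
    intro x hx
    by_cases hd : combDist w x₀ x + 1 ≤ k
    · rw [← G.mul_lap_eq_sum u x B', hharm x hx, mul_zero, mul_zero]
      intro y hy
      rw [hB']
      linarith [(abs_le.1 (G.abs_dist_sub_le_one x₀ hy)).1]
    · have : φ x = 0 := by
        obtain ⟨n, -, -, -, -, hn, -⟩ := exists_geodesic G.conn G.metric x₀ x
        rw [hn] at hd
        have h2 : k ≤ n := by
          have : ¬ (n + 1 ≤ k) := by exact_mod_cast hd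
          omega
        have h2' : (k : ℝ) ≤ n := by exact_mod_cast h2
        simp only [hφ, hn]
        rw [max_eq_left (by linarith)]
      simp [this])
  have hmono : ∀ x y, (u y - u x) * (ψ x - ψ y) ≤ 0 := by
    intro x y
    simp only [hψ]
    split_ifs <;> nlinarith
  have hpt : ∀ x ∈ B', ∀ y ∈ B', φ x * (w x y * ((u y - u x) * (ψ y - ψ x))) +
      w x y * ((u y - u x) * (φ x * ψ x - φ y * ψ y)) ≤ w x y * |u y - u x| := by
    intro x _ y _
    by_cases hw : 0 < w x y
    swap
    · simp [G.eq_zero_of_not_pos hw]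
    have h1 : φ x * (w x y * ((u y - u x) * (ψ y - ψ x))) +
        w x y * ((u y - u x) * (φ x * ψ x - φ y * ψ y)) =
        w x y * ((u y - u x) * ((φ x - φ y) * ψ y)) := by ring
    rw [h1]
    gcongr
    calc (u y - u x) * ((φ x - φ y) * ψ y) ≤ |(u y - u x) * ((φ x - φ y) * ψ y)| := le_abs_self _
      _ = |u y - u x| * (|φ x - φ y| * |ψ y|) := by rw [abs_mul, abs_mul]
      _ ≤ |u y - u x| * (1 * 1) := by
          gcongr
          · exact hφlip x y hw
          · simp only [hψ]
            split_ifs <;> simp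
      _ = _ := by ring
  have hedge : ∀ x y, 0 ≤ φ x * (w x y * ((u y - u x) * (ψ y - ψ x))) := fun x y =>
    mul_nonneg (hφ0 x) (mul_nonneg (G.nonneg x y) (by linarith [hmono x y,
      show (u y - u x) * (ψ y - ψ x) = -((u y - u x) * (ψ x - ψ y)) by ring]))
  have hφx₀ : φ x₀ = k := by simp [hφ, G.dist_self]
  calc (k : ℝ) * (w x₀ y₀ * |u y₀ - u x₀|)
      = φ x₀ * (w x₀ y₀ * ((u y₀ - u x₀) * (ψ y₀ - ψ x₀))) := by
        rw [hφx₀]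
        congr 2
        simp only [hψ]
        rcases lt_trichotomy (u x₀) (u y₀) with h | h | h
        · simp [h.le, h.not_ge, abs_of_pos (sub_pos.2 h)]
        · simp [h]
        · simp [h.le, h.not_ge, abs_of_neg (sub_neg.2 h)]
    _ ≤ ∑ y ∈ B', φ x₀ * (w x₀ y * ((u y - u x₀) * (ψ y - ψ x₀))) :=
        Finset.single_le_sum (f := fun y => φ x₀ * (w x₀ y * ((u y - u x₀) * (ψ y - ψ x₀))))
          (fun y _ => hedge x₀ y) hy₀
    _ ≤ ∑ x ∈ B', ∑ y ∈ B', φ x * (w x y * ((u y - u x) * (ψ y - ψ x))) :=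
        Finset.single_le_sum
          (f := fun x => ∑ y ∈ B', φ x * (w x y * ((u y - u x) * (ψ y - ψ x))))
          (fun x _ => Finset.sum_nonneg fun y _ => hedge x y) hx₀
    _ = ∑ x ∈ B', ∑ y ∈ B', (φ x * (w x y * ((u y - u x) * (ψ y - ψ x))) +
          w x y * ((u y - u x) * (φ x * ψ x - φ y * ψ y))) := by
        simp only [Finset.sum_add_distrib]
        rw [hgreen, add_zero]
    _ ≤ _ := Finset.sum_le_sum fun x hx => Finset.sum_le_sum fun y hy => hpt x hx y hy

/-- Gradient estimate on a ball whose volume is at most linear in its radius. -/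
lemma abs_sub_le_of_linear_volume (G : BoundedGeometry w m c C) {x₀ y₀ : V}
    (hxy : 0 < w x₀ y₀) {k : ℕ} (hk : 1 ≤ k) {u : V → ℝ}
    (hpos : ∀ y, combDist w x₀ y ≤ 2 * k → 0 < u y)
    (hharm : ∀ y, combDist w x₀ y ≤ 2 * k → lap w m u y = 0) {A : ℝ}
    (hA : ∀ F : Finset V, (∀ y ∈ F, combDist w x₀ y ≤ 2 * k) → (F.card : ℝ) ≤ A * k) :
    k * |u y₀ - u x₀| ≤ A * C ^ 2 * Real.exp (2 * √(A * C ^ 2 / c)) / c * u x₀ := by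
  set W := A * C ^ 2 with hWdef
  set H := Real.exp (2 * √(W / c)) with hH
  have hk0 : (0 : ℝ) < k := by exact_mod_cast hk
  set B := (G.balls x₀ (2 * k)).toFinset with hBdef
  set B' := (G.balls x₀ k).toFinset with hB'def
  have hB : ∀ y, y ∈ B ↔ combDist w x₀ y ≤ 2 * k := fun y => by simp [hBdef]
  have hB' : ∀ y, y ∈ B' ↔ combDist w x₀ y ≤ k := fun y => by simp [hB'def]
  have hsub : B' ⊆ B := fun y hy => by
    rw [hB'] at hy
    rw [hB]
    linarith
  have hwB : ∑ x ∈ B, ∑ y ∈ B, w x y ≤ W * k := by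
    calc ∑ x ∈ B, ∑ y ∈ B, w x y ≤ ∑ x ∈ B, C ^ 2 :=
          Finset.sum_le_sum fun x _ => G.sum_weight_le x B
      _ = B.card * C ^ 2 := by simp
      _ ≤ (A * k) * C ^ 2 := by
          gcongr
          exact hA B fun y hy => (hB y).1 hy
      _ = W * k := by rw [hWdef]; ring
  have hwB' : ∑ x ∈ B', ∑ y ∈ B', w x y ≤ W * k := by
    refine le_trans ?_ hwB
    calc ∑ x ∈ B', ∑ y ∈ B', w x y ≤ ∑ x ∈ B', ∑ y ∈ B, w x y :=
          Finset.sum_le_sum fun x _ => Finset.sum_le_sum_of_subset_of_nonneg hsub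
            fun y _ _ => G.nonneg x y
      _ ≤ _ := Finset.sum_le_sum_of_subset_of_nonneg hsub
            fun x _ _ => Finset.sum_nonneg fun y _ => G.nonneg x y
  set q : V → V → ℝ := fun x y => (u y - u x) ^ 2 / (u x * u y) with hq
  have hlog : k * ∑ x ∈ B', ∑ y ∈ B', w x y * q x y ≤ W := by
    have h1 := G.sum_log_energy_le hB hB' (fun y hy => hpos y ((hB y).1 hy))
      (fun y hy => hharm y ((hB y).1 hy))
    have h2 : (k : ℝ) * (k * ∑ x ∈ B', ∑ y ∈ B', w x y * q x y) ≤ k * W := by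
      calc _ = (k : ℝ) ^ 2 * ∑ x ∈ B', ∑ y ∈ B', w x y * q x y := by ring
        _ ≤ W * k := h1.trans hwB
        _ = k * W := mul_comm _ _
    exact le_of_mul_le_mul_left h2 hk0
  have hpos' : ∀ y ∈ B', 0 < u y := fun y hy => hpos y ((hB y).1 (hsub hy))
  have hux₀ : 0 < u x₀ := hpos x₀ (by rw [G.dist_self]; positivity)
  have hharnack := G.le_mul_exp_of_log_energy hB' hpos' hlog
  have hcur := G.mul_current_le hxy hk hB' (fun y hy => hharm y ((hB y).1 (hsub hy)))
  have hW0 : 0 ≤ W := by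
    have : 0 ≤ W * k := le_trans
      (Finset.sum_nonneg fun x _ => Finset.sum_nonneg fun y _ => G.nonneg x y) hwB
    exact nonneg_of_mul_nonneg_left this hk0
  have henergy : k * ∑ x ∈ B', ∑ y ∈ B', w x y * (u y - u x) ^ 2 ≤ W * (H * u x₀) ^ 2 := by
    calc k * ∑ x ∈ B', ∑ y ∈ B', w x y * (u y - u x) ^ 2
        ≤ k * ∑ x ∈ B', ∑ y ∈ B', w x y * q x y * (H * u x₀) ^ 2 := by
          refine mul_le_mul_of_nonneg_left (Finset.sum_le_sum fun x hx =>
            Finset.sum_le_sum fun y hy => ?_) hk0.le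
          have ha := hpos' x hx
          have hb := hpos' y hy
          have h1 : (u y - u x) ^ 2 = q x y * (u x * u y) := by
            simp only [hq]
            field_simp
          have h2 := hharnack x hx
          have h3 := hharnack y hy
          have h4 : u x * u y ≤ (H * u x₀) ^ 2 := by
            rw [sq, mul_comm H]
            gcongr
          have h5 : 0 ≤ q x y := by simp only [hq]; positivity
          calc w x y * (u y - u x) ^ 2 = w x y * q x y * (u x * u y) := by rw [h1]; ring
            _ ≤ _ := mul_le_mul_of_nonneg_left h4 (mul_nonneg (G.nonneg x y) h5)
      _ = (k * ∑ x ∈ B', ∑ y ∈ B', w x y * q x y) * (H * u x₀) ^ 2 := by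
          simp only [← Finset.sum_mul]
          ring
      _ ≤ W * (H * u x₀) ^ 2 := by gcongr
  have hcs : (∑ x ∈ B', ∑ y ∈ B', w x y * |u y - u x|) ^ 2 ≤
      (∑ x ∈ B', ∑ y ∈ B', w x y) * ∑ x ∈ B', ∑ y ∈ B', w x y * (u y - u x) ^ 2 := by
    simp only [← Finset.sum_product']
    refine Finset.sum_sq_le_sum_mul_sum_of_sq_le_mul _ (fun i _ => G.nonneg _ _)
      (fun i _ => mul_nonneg (G.nonneg _ _) (sq_nonneg _)) fun i _ => ?_
    rw [mul_pow, sq_abs]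
    linarith
  have htotal : ∑ x ∈ B', ∑ y ∈ B', w x y * |u y - u x| ≤ W * (H * u x₀) := by
    refine abs_le_of_sq_le_sq' ?_ (by positivity) |>.2
    have hE0 : 0 ≤ ∑ x ∈ B', ∑ y ∈ B', w x y * (u y - u x) ^ 2 :=
      Finset.sum_nonneg fun x _ => Finset.sum_nonneg fun y _ =>
        mul_nonneg (G.nonneg x y) (sq_nonneg _)
    calc _ ≤ _ := hcs
      _ ≤ (W * k) * ∑ x ∈ B', ∑ y ∈ B', w x y * (u y - u x) ^ 2 := by gcongr
      _ = W * (k * ∑ x ∈ B', ∑ y ∈ B', w x y * (u y - u x) ^ 2) := by ring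
      _ ≤ W * (W * (H * u x₀) ^ 2) := by gcongr
      _ = (W * (H * u x₀)) ^ 2 := by ring
  have hfinal : c * (k * |u y₀ - u x₀|) ≤ W * (H * u x₀) := by
    calc c * (k * |u y₀ - u x₀|) ≤ w x₀ y₀ * (k * |u y₀ - u x₀|) := by
          gcongr
          exact (G.c_lt_w _ _ hxy).le
      _ = k * (w x₀ y₀ * |u y₀ - u x₀|) := by ring
      _ ≤ W * (H * u x₀) := hcur.trans htotal
  calc (k : ℝ) * |u y₀ - u x₀| ≤ W * (H * u x₀) / c := by
        rw [le_div_iff₀ G.c_pos]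
        linarith
    _ = W * H / c * u x₀ := by ring

/-- Gradient estimate on the unit ball. -/
lemma abs_sub_le_of_unit_ball (G : BoundedGeometry w m c C) {x₀ y₀ : V}
    (hxy : 0 < w x₀ y₀) {u : V → ℝ} (hpos : ∀ y, combDist w x₀ y ≤ 1 → 0 < u y)
    (hharm : lap w m u x₀ = 0) : |u y₀ - u x₀| ≤ (C ^ 2 / c + 1) * u x₀ := by
  set N := (G.locFin x₀).toFinset with hN
  have hmem : ∀ y, y ∈ N ↔ 0 < w x₀ y := fun y => by simp [hN]
  have hu : ∀ y ∈ N, 0 < u y := fun y hy => hpos y (combDist_le_one ((hmem y).1 hy))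
  have hu₀ : 0 < u x₀ := hpos x₀ (by rw [G.dist_self]; norm_num)
  have h1 := G.mul_lap_eq_sum u x₀ N (fun y hy => (hmem y).2 hy)
  rw [hharm, mul_zero] at h1
  have h2 : ∑ y ∈ N, w x₀ y * u y = (∑ y ∈ N, w x₀ y) * u x₀ := by
    simp only [mul_sub, Finset.sum_sub_distrib] at h1
    rw [Finset.sum_mul]
    linarith
  have h3 : c * u y₀ ≤ C ^ 2 * u x₀ := by
    calc c * u y₀ ≤ w x₀ y₀ * u y₀ := by
          have := hu y₀ ((hmem y₀).2 hxy)
          gcongr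
          exact (G.c_lt_w _ _ hxy).le
      _ ≤ ∑ y ∈ N, w x₀ y * u y := Finset.single_le_sum (f := fun y => w x₀ y * u y)
          (fun y hy => mul_nonneg (G.nonneg _ _) (hu y hy).le) ((hmem y₀).2 hxy)
      _ ≤ C ^ 2 * u x₀ := by
          rw [h2]
          gcongr
          exact G.sum_weight_le x₀ N
  have h4 : u y₀ ≤ C ^ 2 / c * u x₀ := by
    rw [div_mul_eq_mul_div, le_div_iff₀ G.c_pos]
    linarith
  have h5 := hu y₀ ((hmem y₀).2 hxy)
  have h6 : 0 ≤ C ^ 2 / c * u x₀ := by have := G.c_pos; positivity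
  rw [abs_le]
  constructor <;> linarith


/-! ### Curvature and Lipschitz functions -/

lemma lap_sub_lap_le (G : BoundedGeometry w m c C) {f f' : V → ℝ} {x : V} {δ : ℝ}
    (hδ : 0 ≤ δ) (h : ∀ z, 0 < w x z → (f z - f x) - (f' z - f' x) ≤ δ) :
    lap w m f x - lap w m f' x ≤ δ * C := by
  set N := (G.locFin x).toFinset with hN
  have hmem : ∀ y, 0 < w x y → y ∈ N := fun y hy => by simp [hN, hy]
  have h1 : m x * (lap w m f x - lap w m f' x) ≤ m x * (δ * C) := by
    calc m x * (lap w m f x - lap w m f' x)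
        = ∑ z ∈ N, w x z * ((f z - f x) - (f' z - f' x)) := by
          rw [mul_sub, G.mul_lap_eq_sum f x N hmem, G.mul_lap_eq_sum f' x N hmem,
            ← Finset.sum_sub_distrib]
          exact Finset.sum_congr rfl fun z _ => by ring
      _ ≤ ∑ z ∈ N, w x z * δ := by
          refine Finset.sum_le_sum fun z _ => ?_
          by_cases hz : 0 < w x z
          · exact mul_le_mul_of_nonneg_left (h z hz) hz.le
          · simp [G.eq_zero_of_not_pos hz]
      _ = m x * (δ * deg w m x) := by
          rw [← Finset.sum_mul, ← G.mul_deg_eq_sum x N hmem]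
          ring
      _ ≤ m x * (δ * C) := by
          have := (G.m_pos x).le
          have := (G.deg_lt x).le
          gcongr
  exact le_of_mul_le_mul_left h1 (G.m_pos x)

lemma lip1_neg (G : BoundedGeometry w m c C) {f : V → ℝ} (hf : Lip1 (combDist w) f) :
    Lip1 (combDist w) (fun x => -f x) := fun x y => by
  have := hf y x
  rw [G.dist_comm] at this
  linarith

lemma lap_neg (f : V → ℝ) (x : V) : lap w m (fun y => -f y) x = -lap w m f x := by
  rw [lap, lap, ← mul_neg, ← finsum_neg_distrib]
  congr 2
  ext y
  ring

lemma abs_lap_le (G : BoundedGeometry w m c C) {f : V → ℝ} (hf : Lip1 (combDist w) f) (x : V) :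
    |lap w m f x| ≤ C := by
  have key : ∀ g : V → ℝ, Lip1 (combDist w) g → lap w m g x ≤ C := by
    intro g hg
    have h1 := G.lap_sub_lap_le (f := g) (f' := fun _ => 0) (x := x) zero_le_one (fun z hz => by
      have := hg x z
      rw [G.dist_eq_one hz] at this
      linarith)
    have h2 : lap w m (fun _ => 0) x = 0 := by simp [lap]
    linarith
  have h1 := key _ (G.lip1_neg hf)
  rw [lap_neg] at h1
  exact abs_le.2 ⟨by linarith, key f hf⟩

/-- Along an edge of maximal slope the Laplacian is non-increasing. -/
lemma lap_le_of_edge (G : BoundedGeometry w m c C) (hcurv : NonnegCurv w m (combDist w))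
    {f : V → ℝ} (hf : Lip1 (combDist w) f) {x y : V} (hxy : 0 < w x y)
    (hmax : f y - f x = 1) : lap w m f y ≤ lap w m f x := by
  have h := hcurv x y hxy
  rw [kappa, G.dist_eq_one hxy, inv_one, one_mul] at h
  have h1 : sInf {c | ∃ f : V → ℝ, Lip1 (combDist w) f ∧ f y - f x = 1 ∧
      c = lap w m f x - lap w m f y} ≤ lap w m f x - lap w m f y := by
    refine csInf_le ⟨-(2 * C), ?_⟩ ⟨f, hf, hmax, rfl⟩
    rintro _ ⟨g, hg, -, rfl⟩
    have h2 := abs_le.1 (G.abs_lap_le hg x)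
    have h3 := abs_le.1 (G.abs_lap_le hg y)
    linarith
  linarith

lemma lap_le_of_geodesic (G : BoundedGeometry w m c C) (hcurv : NonnegCurv w m (combDist w))
    {f : V → ℝ} (hf : Lip1 (combDist w) f) {x y : V}
    (hmax : f y = f x + combDist w x y) : lap w m f y ≤ lap w m f x := by
  obtain ⟨n, p, h0, hn, hp, hdist, hpd⟩ := exists_geodesic G.conn G.metric x y
  have hfp : ∀ i ≤ n, f (p i) = f x + i := by
    intro i hi
    have h1 := hf x (p i)
    have h2 := hf (p i) y
    rw [hpd i hi] at h1
    have h3 := combDist_le_of_path (w := w) (n - i) (fun j => p (i + j)) (fun j hj => by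
      have := hp (i + j) (by omega)
      rwa [add_assoc] at this)
    simp only [add_zero, Nat.add_sub_cancel' hi, hn, Nat.cast_sub hi] at h3
    rw [hdist] at hmax
    linarith
  have hind : ∀ i ≤ n, lap w m f (p i) ≤ lap w m f x := by
    intro i
    induction i with
    | zero => simp [h0]
    | succ i ih =>
      intro hi
      refine (G.lap_le_of_edge hcurv hf (hp i hi) ?_).trans (ih (by omega))
      rw [hfp _ hi, hfp i (by omega)]
      push_cast
      ring
  rw [← hn]
  exact hind n le_rfl

/-- The lazy averaging operator preserves `Lip(1)` in non-negative curvature. -/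
lemma lip1_add_lap (G : BoundedGeometry w m c C) (hcurv : NonnegCurv w m (combDist w))
    {f : V → ℝ} (hf : Lip1 (combDist w) f) :
    Lip1 (combDist w) (fun x => f x + (2 * C)⁻¹ * lap w m f x) := by
  refine lip1_of_edges G.conn G.metric fun x y hxy => ?_
  have hC := G.C_pos x
  have hd := G.dist_eq_one hxy
  set δ := 1 - (f y - f x) with hδ
  have hδ0 : 0 ≤ δ := by
    have := hf x y
    rw [hd] at this
    linarith
  set f' : V → ℝ := fun z => min (f z) (f y - 1 + combDist w x z) with hf'
  have hf'lip : Lip1 (combDist w) f' := by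
    intro a b
    have h1 := hf a b
    have h2 := G.dist_triangle x a b
    have h3 : min (f b) (f y - 1 + combDist w x b) ≤
        min (f a) (f y - 1 + combDist w x a) + combDist w a b := by
      rw [← min_add_add_right]
      exact min_le_min (by linarith) (by linarith)
    simp only [hf']
    linarith
  have hf'y : f' y = f y := by simp [hf', hd]
  have hf'x : f' x = f y - 1 := by
    simp only [hf', G.dist_self, add_zero]
    exact min_eq_right (by linarith)
  have hf'le : ∀ z, f' z ≤ f z := fun z => min_le_left _ _
  have hlef' : ∀ z, f z - δ ≤ f' z := fun z => by
    have := hf x z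
    exact le_min (by linarith) (by linarith)
  have h1 := G.lap_le_of_edge hcurv hf'lip hxy (by rw [hf'y, hf'x]; ring)
  have h2 := G.lap_sub_lap_le (f := f) (f' := f') (x := y) hδ0 (fun z _ => by
    linarith [hlef' z])
  have h3 := G.lap_sub_lap_le (f := f') (f' := f) (x := x) hδ0 (fun z _ => by
    linarith [hf'le z])
  have h4 : (2 * C)⁻¹ * (lap w m f y - lap w m f x) ≤ δ := by
    rw [inv_mul_le_iff₀ (by positivity)]
    linarith
  linarith

/-- The lazy averaging operator is non-expansive. -/
lemma add_lap_sub_le (G : BoundedGeometry w m c C) {f f' : V → ℝ} {δ : ℝ}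
    (h : ∀ z, f z - f' z ≤ δ) (x : V) :
    (f x + (2 * C)⁻¹ * lap w m f x) - (f' x + (2 * C)⁻¹ * lap w m f' x) ≤ δ := by
  have hC := G.C_pos x
  have h1 := G.lap_sub_lap_le (f := f) (f' := f') (x := x) (δ := δ - (f x - f' x))
    (by linarith [h x]) (fun z _ => by linarith [h z])
  have h2 : (2 * C)⁻¹ * (lap w m f x - lap w m f' x) ≤ δ - (f x - f' x) := by
    rw [inv_mul_le_iff₀ (by positivity)]
    nlinarith [h x]
  linarith

end BoundedGeometry

/-! ### Functions growing at unit speed on one side of a finite set -/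

/-- `f` is a `1`-Lipschitz function growing with unit speed away from the finite set `K` on `Y`,
where `Y` is only adjacent to itself and `K`. -/
structure IsSideFunction (w : V → V → ℝ) (Y K : Set V) (f : V → ℝ) : Prop where
  lip : Lip1 (combDist w) f
  finite : K.Finite
  disj : Disjoint Y K
  closed : ∀ y ∈ Y, ∀ z, 0 < w y z → z ∈ Y ∨ z ∈ K
  dist_eq : ∀ y ∈ Y, ∃ k ∈ K, f y = f k + combDist w k y

namespace IsSideFunction

variable {w : V → V → ℝ} {m : V → ℝ} {c C : ℝ} {Y K : Set V} {f : V → ℝ}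

lemma sublevel_finite (hf : IsSideFunction w Y K f) (G : BoundedGeometry w m c C) (t : ℝ) :
    {y | y ∈ Y ∧ f y < t}.Finite := by
  refine (hf.finite.biUnion fun k _ => G.balls k (t - f k)).subset ?_
  rintro y ⟨hy, hyt⟩
  obtain ⟨k, hk, hky⟩ := hf.dist_eq y hy
  refine Set.mem_biUnion hk ?_
  change combDist w k y ≤ t - f k
  linarith

lemma exists_lower_neighbor (hf : IsSideFunction w Y K f) (G : BoundedGeometry w m c C) {y : V}
    (hy : y ∈ Y) : ∃ z, 0 < w y z ∧ f z = f y - 1 := by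
  obtain ⟨k, hk, hky⟩ := hf.dist_eq y hy
  have hne : k ≠ y := fun h => Set.disjoint_left.1 hf.disj hy (h ▸ hk)
  obtain ⟨n, p, h0, hn, hp, hdist, hpd⟩ := exists_geodesic G.conn G.metric k y
  have hn0 : n ≠ 0 := by
    rintro rfl
    exact hne (h0.symm.trans hn)
  obtain ⟨n, rfl⟩ := Nat.exists_eq_succ_of_ne_zero hn0
  have hadj := hp n (by omega)
  rw [hn, G.symm] at hadj
  refine ⟨p n, hadj, ?_⟩
  have h1 := hf.lip k (p n)
  have h2 := hf.lip (p n) y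
  rw [G.dist_comm, G.dist_eq_one hadj] at h2
  rw [hpd n (by omega)] at h1
  rw [hdist] at hky
  push_cast at hky
  linarith

/-- The flux of `f` out of a sublevel set is controlled by the Laplacian of `f` inside. -/
lemma flux_le (hf : IsSideFunction w Y K f) (G : BoundedGeometry w m c C) (t : ℝ)
    (P : Finset V) (hP : ∀ y ∈ P, y ∈ Y ∧ t ≤ f y) :
    ∑ x ∈ (hf.sublevel_finite G t).toFinset, ∑ y ∈ P, w x y * (f y - f x) ≤
      ∑ x ∈ (hf.sublevel_finite G t).toFinset, m x * lap w m f x +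
        hf.finite.toFinset.card * C ^ 2 := by
  classical
  set D := (hf.sublevel_finite G t).toFinset with hDdef
  set L := hf.finite.toFinset with hLdef
  have hD : ∀ y, y ∈ D ↔ y ∈ Y ∧ f y < t := fun y => by simp [hDdef]
  have hL : ∀ y, y ∈ L ↔ y ∈ K := fun y => by simp [hLdef]
  set B := D ∪ (D.biUnion (fun x => (G.locFin x).toFinset) ∪ P ∪ L) with hB
  have hDB : D ⊆ B := Finset.subset_union_left
  have hPB : P ⊆ B \ D := fun y hy => by
    have h1 := (hP y hy).2
    rw [Finset.mem_sdiff, hD]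
    exact ⟨by simp [hB, hy], fun h => by linarith [h.2]⟩
  have hlap : ∀ x ∈ D, m x * lap w m f x =
      ∑ y ∈ D, w x y * (f y - f x) + ∑ y ∈ B \ D, w x y * (f y - f x) := by
    intro x hx
    rw [G.mul_lap_eq_sum f x B, ← Finset.sum_sdiff hDB, add_comm]
    intro y hy
    simp only [hB, Finset.mem_union, Finset.mem_biUnion]
    exact Or.inr (Or.inl (Or.inl ⟨x, hx, by simpa using hy⟩))
  have hpt : ∀ x ∈ D, ∀ y ∈ B \ D, (if y ∈ P then w x y * (f y - f x) else 0) ≤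
      w x y * (f y - f x) + if y ∈ L then w x y else 0 := by
    intro x hx y hy
    rw [Finset.mem_sdiff, hD] at hy
    rw [hD] at hx
    by_cases hw : 0 < w x y
    swap
    · simp [G.eq_zero_of_not_pos hw]
    rcases hf.closed x hx.1 y hw with hyY | hyK
    · have hyL : y ∉ L := fun h => Set.disjoint_left.1 hf.disj hyY ((hL y).1 h)
      have hty : t ≤ f y := not_lt.1 fun h => hy.2 ⟨hyY, h⟩
      have : 0 ≤ w x y * (f y - f x) := mul_nonneg hw.le (by linarith [hx.2])
      rw [if_neg hyL]
      split_ifs <;> linarith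
    · have hyP : y ∉ P := fun h => Set.disjoint_left.1 hf.disj (hP y h).1 hyK
      have h1 := hf.lip y x
      rw [G.dist_comm, G.dist_eq_one hw] at h1
      rw [if_neg hyP, if_pos ((hL y).2 hyK)]
      nlinarith
  calc ∑ x ∈ D, ∑ y ∈ P, w x y * (f y - f x)
      = ∑ x ∈ D, ∑ y ∈ B \ D, (if y ∈ P then w x y * (f y - f x) else 0) := by
        refine Finset.sum_congr rfl fun x _ => ?_
        rw [← Finset.sum_filter, Finset.filter_mem_eq_inter, Finset.inter_eq_right.2 hPB]
    _ ≤ ∑ x ∈ D, ∑ y ∈ B \ D, (w x y * (f y - f x) + if y ∈ L then w x y else 0) :=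
        Finset.sum_le_sum fun x hx => Finset.sum_le_sum fun y hy => hpt x hx y hy
    _ = ∑ x ∈ D, m x * lap w m f x +
          ∑ x ∈ D, ∑ y ∈ B \ D, (if y ∈ L then w x y else 0) := by
        simp only [Finset.sum_add_distrib]
        rw [Finset.sum_congr rfl hlap, Finset.sum_add_distrib, sum_sum_antisymm G.symm, zero_add]
    _ ≤ ∑ x ∈ D, m x * lap w m f x + L.card * C ^ 2 := by
        gcongr
        calc ∑ x ∈ D, ∑ y ∈ B \ D, (if y ∈ L then w x y else 0) ≤ ∑ x ∈ D, ∑ y ∈ L, w x y := by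
              refine Finset.sum_le_sum fun x _ => ?_
              rw [← Finset.sum_filter]
              refine Finset.sum_le_sum_of_subset_of_nonneg ?_ fun y _ _ => G.nonneg x y
              intro y hy
              exact (Finset.mem_filter.1 hy).2
          _ = ∑ y ∈ L, ∑ x ∈ D, w y x := by
              rw [Finset.sum_comm]
              simp only [G.symm]
          _ ≤ ∑ y ∈ L, C ^ 2 := Finset.sum_le_sum fun y _ => G.sum_weight_le y D
          _ = L.card * C ^ 2 := by simp

lemma lap_le (hf : IsSideFunction w Y K f) (G : BoundedGeometry w m c C)
    (hcurv : NonnegCurv w m (combDist w)) {a : ℝ} (ha : ∀ k ∈ K, lap w m f k ≤ a) :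
    ∀ y ∈ Y, lap w m f y ≤ a := fun y hy => by
  obtain ⟨k, hk, hky⟩ := hf.dist_eq y hy
  exact (G.lap_le_of_geodesic hcurv hf.lip hky).trans (ha k hk)

lemma exists_lap_nonneg (hf : IsSideFunction w Y K f) (G : BoundedGeometry w m c C)
    (hcurv : NonnegCurv w m (combDist w)) (hK : K.Nonempty) (hvol : InfVolume m Y) :
    ∃ k ∈ K, 0 ≤ lap w m f k := by
  by_contra! hneg
  obtain ⟨k₀, hk₀, hmax⟩ := Set.exists_max_image K (lap w m f) hf.finite hK
  have hδ := hneg k₀ hk₀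
  set δ := -lap w m f k₀ with hδdef
  have hδ0 : 0 < δ := by linarith
  have hlap := hf.lap_le G hcurv (a := -δ) (fun k hk => by linarith [hmax k hk])
  obtain ⟨F, hFY, hF⟩ := hvol (hf.finite.toFinset.card * C ^ 2 / δ)
  obtain ⟨t, ht⟩ : ∃ t, ∀ y ∈ F, f y < t := by
    obtain ⟨M, hM⟩ := (F.finite_toSet.image f).bddAbove
    exact ⟨M + 1, fun y hy => by linarith [hM ⟨y, hy, rfl⟩]⟩
  have hflux := hf.flux_le G t ∅ (by simp)
  set D := (hf.sublevel_finite G t).toFinset with hDdef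
  have hD : ∀ y, y ∈ D ↔ y ∈ Y ∧ f y < t := fun y => by simp [hDdef]
  have h1 : ∑ x ∈ D, m x * lap w m f x ≤ -δ * ∑ x ∈ F, m x := by
    calc ∑ x ∈ D, m x * lap w m f x ≤ ∑ x ∈ D, m x * (-δ) :=
          Finset.sum_le_sum fun x hx =>
            mul_le_mul_of_nonneg_left (hlap x ((hD x).1 hx).1) (G.m_pos x).le
      _ = -δ * ∑ x ∈ D, m x := by rw [← Finset.sum_mul, mul_comm]
      _ ≤ -δ * ∑ x ∈ F, m x := by
          refine mul_le_mul_of_nonpos_left ?_ (by linarith)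
          exact Finset.sum_le_sum_of_subset_of_nonneg
            (fun y hy => (hD y).2 ⟨hFY hy, ht y hy⟩) fun x _ _ => (G.m_pos x).le
  rw [div_lt_iff₀ hδ0] at hF
  simp only [Finset.sum_empty, Finset.sum_const_zero] at hflux
  linarith

/-- Level sets of a superharmonic side function have uniformly bounded size. -/
lemma exists_card_level_le (hf : IsSideFunction w Y K f) (G : BoundedGeometry w m c C)
    (hcurv : NonnegCurv w m (combDist w)) (hK : ∀ k ∈ K, lap w m f k ≤ 0) :
    ∃ N : ℝ, ∀ (t : ℝ) (L : Finset V), (∀ y ∈ L, y ∈ Y ∧ t ≤ f y ∧ f y < t + 1) →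
      (L.card : ℝ) ≤ N := by
  classical
  set M := hf.finite.toFinset.biUnion (fun k => (G.locFin k).toFinset) with hM
  refine ⟨hf.finite.toFinset.card * C ^ 2 / c + M.card, fun t L hL => ?_⟩
  set P := L \ M with hPdef
  have hcard : L.card ≤ P.card + M.card := by
    have : L.card - M.card ≤ P.card := Finset.le_card_sdiff M L
    omega
  have hflux := hf.flux_le G t P (fun y hy =>
    have h := hL y (Finset.mem_sdiff.1 hy).1
    ⟨h.1, h.2.1⟩)
  set D := (hf.sublevel_finite G t).toFinset with hDdef
  have hD : ∀ y, y ∈ D ↔ y ∈ Y ∧ f y < t := fun y => by simp [hDdef]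
  have h1 : ∑ x ∈ D, m x * lap w m f x ≤ 0 := Finset.sum_nonpos fun x hx =>
    mul_nonpos_of_nonneg_of_nonpos (G.m_pos x).le (hf.lap_le G hcurv hK x ((hD x).1 hx).1)
  have h2 : P.card * c ≤ ∑ x ∈ D, ∑ y ∈ P, w x y * (f y - f x) := by
    rw [Finset.sum_comm, ← nsmul_eq_mul]
    refine Finset.card_nsmul_le_sum _ _ _ fun y hy => ?_
    obtain ⟨hyL, hyM⟩ := Finset.mem_sdiff.1 hy
    obtain ⟨hyY, hty, hyt⟩ := hL y hyL
    obtain ⟨z, hz, hfz⟩ := hf.exists_lower_neighbor G hyY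
    have hzK : z ∉ K := fun h => hyM (by
      simp only [hM, Finset.mem_biUnion]
      exact ⟨z, by simpa using h, by simpa [G.symm z y] using hz⟩)
    have hzD : z ∈ D := (hD z).2 ⟨(hf.closed y hyY z hz).resolve_right hzK, by linarith⟩
    calc c ≤ w z y * (f y - f z) := by
          rw [hfz, G.symm]
          linarith [G.c_lt_w y z hz]
      _ ≤ _ := Finset.single_le_sum (f := fun x => w x y * (f y - f x)) (fun x hx =>
          mul_nonneg (G.nonneg x y) (by linarith [((hD x).1 hx).2])) hzD
  have h3 : (P.card : ℝ) ≤ hf.finite.toFinset.card * C ^ 2 / c := by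
    rw [le_div_iff₀ G.c_pos]
    linarith
  have h4 : (L.card : ℝ) ≤ P.card + M.card := by exact_mod_cast hcard
  linarith

lemma exists_card_le_mul (hf : IsSideFunction w Y K f) (G : BoundedGeometry w m c C)
    (hcurv : NonnegCurv w m (combDist w)) (hK : ∀ k ∈ K, lap w m f k ≤ 0) :
    ∃ N : ℝ, 0 ≤ N ∧ ∀ (x₀ : V) (k : ℕ), 1 ≤ k → ∀ F : Finset V,
      (∀ y ∈ F, y ∈ Y ∧ combDist w x₀ y ≤ 2 * k) → (F.card : ℝ) ≤ N * k := by
  classical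
  obtain ⟨N, hN⟩ := hf.exists_card_level_le G hcurv hK
  have hN0 : 0 ≤ N := by simpa using hN 0 ∅ (by simp)
  refine ⟨5 * N, by positivity, fun x₀ k hk F hF => ?_⟩
  set s : V → ℝ := fun y => f y - (f x₀ - 2 * k) with hs
  have hs0 : ∀ y ∈ F, 0 ≤ s y ∧ s y ≤ 4 * k := fun y hy => by
    have h1 := hf.lip x₀ y
    have h2 := hf.lip y x₀
    rw [G.dist_comm] at h2
    have h3 := (hF y hy).2
    exact ⟨by simp only [hs]; linarith, by simp only [hs]; linarith⟩
  have hcard := Finset.card_eq_sum_card_fiberwise (s := F) (t := Finset.range (4 * k + 1))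
    (f := fun y => ⌊s y⌋₊) (fun y hy => by
      have h1 : ⌊s y⌋₊ ≤ 4 * k := Nat.floor_le_of_le (by exact_mod_cast (hs0 y hy).2)
      simpa using Nat.lt_succ_of_le h1)
  rw [hcard]
  push_cast
  calc ∑ j ∈ Finset.range (4 * k + 1), ((F.filter fun y => ⌊s y⌋₊ = j).card : ℝ)
      ≤ ∑ j ∈ Finset.range (4 * k + 1), N := by
        refine Finset.sum_le_sum fun j _ => hN (f x₀ - 2 * k + j) _ fun y hy => ?_
        obtain ⟨hyF, hyj⟩ := Finset.mem_filter.1 hy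
        have h1 := (Nat.floor_eq_iff (hs0 y hyF).1).1 hyj
        simp only [hs] at h1
        exact ⟨(hF y hyF).1, by linarith, by linarith⟩
    _ = (4 * k + 1) * N := by simp
    _ ≤ 5 * N * k := by
        have : (1 : ℝ) ≤ k := by exact_mod_cast hk
        nlinarith

end IsSideFunction

/-! ### Extremal Lipschitz extensions -/

/-- The McShane extension `v ↦ min_{k ∈ K} (g(k) + d(v,k))`. -/
noncomputable def mcShane (d : V → V → ℝ) (K : Set V) (g : K → ℝ) (v : V) : ℝ :=
  ⨅ k : K, (g k + d v k)

section McShane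

variable {d : V → V → ℝ} {K : Set V} [Finite K]

lemma mcShane_le (g : K → ℝ) (v : V) (k : K) : mcShane d K g v ≤ g k + d v k :=
  ciInf_le (Set.finite_range _).bddBelow k

lemma exists_mcShane_eq [Nonempty K] (g : K → ℝ) (v : V) :
    ∃ k : K, mcShane d K g v = g k + d v k := by
  obtain ⟨k, hk⟩ := exists_eq_ciInf_of_finite (f := fun k : K => g k + d v k)
  exact ⟨k, hk.symm⟩

lemma mcShane_sub_le [Nonempty K] {g g' : K → ℝ} {δ : ℝ} (h : ∀ k, g k - g' k ≤ δ) (v : V) :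
    mcShane d K g v - mcShane d K g' v ≤ δ := by
  obtain ⟨k, hk⟩ := exists_mcShane_eq (d := d) g' v
  linarith [mcShane_le (d := d) g v k, h k]

lemma lip1_mcShane [Nonempty K] (hsymm : ∀ x y, d x y = d y x)
    (htri : ∀ x y z, d x z ≤ d x y + d y z) (g : K → ℝ) : Lip1 d (mcShane d K g) := by
  intro x y
  obtain ⟨k, hk⟩ := exists_mcShane_eq (d := d) g x
  linarith [mcShane_le (d := d) g y k, htri y x k, hsymm x y]

lemma mcShane_eq [Nonempty K] (hself : ∀ x, d x x = 0) {g : K → ℝ}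
    (hg : ∀ a b : K, g b - g a ≤ d a b) (hsymm : ∀ x y, d x y = d y x) (k : K) :
    mcShane d K g k = g k := by
  apply le_antisymm
  · have := mcShane_le (d := d) g k k
    rwa [hself, add_zero] at this
  · refine le_ciInf fun a => ?_
    linarith [hg a k, hsymm a k]

end McShane

open Classical in
/-- The extremal Lipschitz extension: minimal slope `+1` away from `K` on `Y`, slope `-1`
elsewhere. -/
noncomputable def extremalExt (d : V → V → ℝ) (Y K : Set V) (g : K → ℝ) (v : V) : ℝ :=
  if v ∈ Y then mcShane d K g v else -mcShane d K (fun k => -g k) v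

lemma extremalExt_sub_le {d : V → V → ℝ} {Y K : Set V} [Finite K] [Nonempty K] {g g' : K → ℝ}
    {δ : ℝ} (h : ∀ k, g k - g' k ≤ δ) (v : V) :
    extremalExt d Y K g v - extremalExt d Y K g' v ≤ δ := by
  unfold extremalExt
  split_ifs
  · exact mcShane_sub_le h v
  · have := mcShane_sub_le (d := d) (g := fun k => -g' k) (g' := fun k => -g k) (δ := δ)
      (fun k => by linarith [h k]) v
    linarith

section ExtremalExt

variable {w : V → V → ℝ} {m : V → ℝ} {c C : ℝ} {X Y K : Set V}

lemma SalamiPartition.mem_right (hP : SalamiPartition w m X Y K) {v : V} (hX : v ∉ X)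
    (hK : v ∉ K) : v ∈ Y := by
  have : v ∈ X ∪ Y ∪ K := hP.1 ▸ Set.mem_univ v
  simpa [hX, hK] using this

lemma SalamiPartition.mem_left (hP : SalamiPartition w m X Y K) {v : V} (hY : v ∉ Y)
    (hK : v ∉ K) : v ∈ X := by
  have : v ∈ X ∪ Y ∪ K := hP.1 ▸ Set.mem_univ v
  simpa [hY, hK] using this

lemma SalamiPartition.closed_right (hP : SalamiPartition w m X Y K)
    (hw : ∀ x y, w x y = w y x) {y z : V} (hy : y ∈ Y) (hyz : 0 < w y z) : z ∈ Y ∨ z ∈ K := by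
  by_contra! h
  have h1 := hP.2.2.2.2.2.1 z (hP.mem_left h.1 h.2) y hy
  rw [hw, h1] at hyz
  exact lt_irrefl _ hyz

lemma SalamiPartition.closed_left (hP : SalamiPartition w m X Y K)
    {x z : V} (hx : x ∈ X) (hxz : 0 < w x z) : z ∈ X ∨ z ∈ K := by
  by_contra! h
  have h1 := hP.2.2.2.2.2.1 x hx z (hP.mem_right h.1 h.2)
  rw [h1] at hxz
  exact lt_irrefl _ hxz

lemma SalamiPartition.nonempty (hP : SalamiPartition w m X Y K) (hconn : GraphConnected w) :
    K.Nonempty := by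
  have hne : ∀ A : Set V, InfVolume m A → A.Nonempty := by
    intro A hA
    obtain ⟨F, hF, h⟩ := hA 0
    obtain ⟨x, hx⟩ : F.Nonempty := by
      by_contra hemp
      simp [Finset.not_nonempty_iff_eq_empty.1 hemp] at h
    exact ⟨x, hF hx⟩
  obtain ⟨x, hx⟩ := hne X hP.2.2.2.2.2.2.1
  obtain ⟨y, hy⟩ := hne Y hP.2.2.2.2.2.2.2
  by_contra hK
  have hKe := Set.not_nonempty_iff_eq_empty.1 hK
  have hreach : ∀ z, Relation.ReflTransGen (fun a b => 0 < w a b) x z → z ∈ X := by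
    intro z hz
    induction hz with
    | refl => exact hx
    | tail _ hab ih => exact (hP.closed_left ih hab).resolve_right (by simp [hKe])
  exact Set.disjoint_left.1 hP.2.1 (hreach y (hconn x y)) hy

/-- The functions on `K` which are `1`-Lipschitz. -/
def lipOn (d : V → V → ℝ) (K : Set V) : Set (K → ℝ) := {g | ∀ a b : K, g b - g a ≤ d a b}

lemma isClosed_lipOn (d : V → V → ℝ) (K : Set V) : IsClosed (lipOn d K) := by
  have : lipOn d K = ⋂ (a : K) (b : K), {g : K → ℝ | g b - g a ≤ d a b} := by
    ext g
    simp [lipOn]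
  rw [this]
  exact isClosed_iInter fun a => isClosed_iInter fun b =>
    isClosed_le (by fun_prop) continuous_const

lemma neg_mem_lipOn (G : BoundedGeometry w m c C) {g : K → ℝ} (hg : g ∈ lipOn (combDist w) K) :
    (fun k => -g k) ∈ lipOn (combDist w) K := fun a b => by
  have := hg b a
  rw [G.dist_comm] at this
  linarith

variable [Finite K] [Nonempty K]

lemma extremalExt_eq (hP : SalamiPartition w m X Y K) (G : BoundedGeometry w m c C) {g : K → ℝ}
    (hg : g ∈ lipOn (combDist w) K) (k : K) :
    extremalExt (combDist w) Y K g k = g k := by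
  have hkY : (k : V) ∉ Y := fun h => Set.disjoint_left.1 hP.2.2.2.1 h k.2
  rw [extremalExt, if_neg hkY, mcShane_eq G.dist_self (neg_mem_lipOn G hg) G.dist_comm, neg_neg]

lemma extremalExt_eq_mcShane (hP : SalamiPartition w m X Y K) (G : BoundedGeometry w m c C)
    {g : K → ℝ} (hg : g ∈ lipOn (combDist w) K) {v : V} (hv : v ∈ Y ∨ v ∈ K) :
    extremalExt (combDist w) Y K g v = mcShane (combDist w) K g v := by
  rcases hv with hv | hv
  · rw [extremalExt, if_pos hv]
  · lift v to K using hv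
    rw [extremalExt_eq hP G hg, mcShane_eq G.dist_self hg G.dist_comm]

lemma lip1_extremalExt (hP : SalamiPartition w m X Y K) (G : BoundedGeometry w m c C) {g : K → ℝ}
    (hg : g ∈ lipOn (combDist w) K) : Lip1 (combDist w) (extremalExt (combDist w) Y K g) := by
  have hM := fun g : K → ℝ => lip1_mcShane (d := combDist w) G.dist_comm G.dist_triangle g
  have hupper : ∀ {v}, v ∉ Y → extremalExt (combDist w) Y K g v =
      -mcShane (combDist w) K (fun k => -g k) v := fun hv => if_neg hv
  refine lip1_of_edges G.conn G.metric fun x y hxy => ?_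
  have h1 := hM g x y
  have h2 := hM (fun k => -g k) y x
  rw [G.dist_eq_one hxy] at h1
  rw [G.dist_comm, G.dist_eq_one hxy] at h2
  by_cases hx : x ∈ Y
  · rwa [extremalExt_eq_mcShane hP G hg (Or.inl hx),
      extremalExt_eq_mcShane hP G hg (hP.closed_right G.symm hx hxy)]
  by_cases hy : y ∈ Y
  · rwa [extremalExt_eq_mcShane hP G hg (Or.inl hy),
      extremalExt_eq_mcShane hP G hg (hP.closed_right G.symm hy (by rwa [G.symm]))]
  rw [hupper hx, hupper hy]
  linarith

lemma isSideFunction_extremalExt (hP : SalamiPartition w m X Y K) (G : BoundedGeometry w m c C)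
    {g : K → ℝ} (hg : g ∈ lipOn (combDist w) K) :
    IsSideFunction w Y K (extremalExt (combDist w) Y K g) where
  lip := lip1_extremalExt hP G hg
  finite := Set.toFinite K
  disj := hP.2.2.2.1
  closed y hy z hz := hP.closed_right G.symm hy hz
  dist_eq y hy := by
    obtain ⟨k, hk⟩ := exists_mcShane_eq (d := combDist w) g y
    refine ⟨k, k.2, ?_⟩
    rw [extremalExt_eq hP G hg, extremalExt_eq_mcShane hP G hg (Or.inl hy), hk, G.dist_comm]

lemma isSideFunction_neg_extremalExt (hP : SalamiPartition w m X Y K)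
    (G : BoundedGeometry w m c C) {g : K → ℝ} (hg : g ∈ lipOn (combDist w) K) :
    IsSideFunction w X K (fun v => -extremalExt (combDist w) Y K g v) where
  lip := G.lip1_neg (lip1_extremalExt hP G hg)
  finite := Set.toFinite K
  disj := hP.2.2.1
  closed y hy z hz := hP.closed_left hy hz
  dist_eq y hy := by
    obtain ⟨k, hk⟩ := exists_mcShane_eq (d := combDist w) (fun k => -g k) y
    refine ⟨k, k.2, ?_⟩
    have hyY : y ∉ Y := Set.disjoint_left.1 hP.2.1 hy
    rw [extremalExt_eq hP G hg, extremalExt, if_neg hyY, hk, G.dist_comm, neg_neg]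

/-- A discounted fixed point of the extension of the lazy averaging operator. -/
lemma exists_lap_eq_smul (hP : SalamiPartition w m X Y K) (G : BoundedGeometry w m c C)
    (hcurv : NonnegCurv w m (combDist w)) {η : ℝ} (hη : 0 < η) :
    ∃ g ∈ lipOn (combDist w) K, ∀ k : K,
      (2 * C)⁻¹ * lap w m (extremalExt (combDist w) Y K g) k = η * g k := by
  have := Fintype.ofFinite K
  set S := extremalExt (combDist w) Y K with hS
  set r : ℝ := (1 + η)⁻¹ with hr
  have hr0 : 0 < r := by positivity
  have hr1 : r < 1 := inv_lt_one_of_one_lt₀ (by linarith)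
  set Ψ : (K → ℝ) → K → ℝ := fun g k => r * (S g k + (2 * C)⁻¹ * lap w m (S g) k) with hΨ
  have hmaps : Set.MapsTo Ψ (lipOn (combDist w) K) (lipOn (combDist w) K) := by
    intro g hg a b
    have h1 := G.lip1_add_lap hcurv (lip1_extremalExt hP G hg) a b
    have h2 : (0 : ℝ) ≤ combDist w a b := by
      obtain ⟨n, -, -, -, -, hn, -⟩ := exists_geodesic G.conn G.metric (a : V) b
      rw [hn]
      positivity
    simp only [hΨ, ← mul_sub]
    calc _ ≤ r * combDist w a b := mul_le_mul_of_nonneg_left h1 hr0.le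
      _ ≤ 1 * combDist w a b := by gcongr
      _ = combDist w a b := one_mul _
  have hone : ∀ g g' : K → ℝ, ∀ k, Ψ g k - Ψ g' k ≤ r * dist g g' := by
    intro g g' k
    have h1 := G.add_lap_sub_le (f := S g) (f' := S g') (δ := dist g g') (fun v =>
      extremalExt_sub_le (fun k => (le_abs_self _).trans (dist_le_pi_dist g g' k)) v) k
    simp only [hΨ, ← mul_sub]
    exact mul_le_mul_of_nonneg_left h1 hr0.le
  have hcontr : ContractingWith ⟨r, hr0.le⟩ Ψ := by
    refine ⟨by exact_mod_cast hr1, LipschitzWith.of_dist_le_mul fun g g' => ?_⟩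
    refine (dist_pi_le_iff (by positivity)).2 fun k => ?_
    rw [Real.dist_eq, abs_sub_le_iff]
    refine ⟨hone g g' k, ?_⟩
    rw [dist_comm]
    exact hone g' g k
  have hzero : (0 : K → ℝ) ∈ lipOn (combDist w) K := fun a b => by
    obtain ⟨n, -, -, -, -, hn, -⟩ := exists_geodesic G.conn G.metric (a : V) b
    rw [hn]
    simp
  obtain ⟨g, hg, hfix, -⟩ := ContractingWith.exists_fixedPoint'
    (isClosed_lipOn (combDist w) K).isComplete hmaps (hcontr.restrict hmaps) hzero
    (edist_ne_top _ _)
  refine ⟨g, hg, fun k => ?_⟩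
  have h1 : Ψ g k = g k := congrFun hfix k
  simp only [hΨ, hr, hS, extremalExt_eq hP G hg] at h1
  rw [inv_mul_eq_iff_eq_mul₀ (by positivity)] at h1
  linarith

/-- There is an extremal Lipschitz function harmonic on `K`. -/
lemma exists_lap_eq_zero (hP : SalamiPartition w m X Y K) (G : BoundedGeometry w m c C)
    (hcurv : NonnegCurv w m (combDist w)) :
    ∃ g ∈ lipOn (combDist w) K, ∀ k ∈ K,
      lap w m (extremalExt (combDist w) Y K g) k = 0 := by
  have := Fintype.ofFinite K
  have hKne : K.Nonempty := Set.nonempty_coe_sort.1 inferInstance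
  have hC : 0 < C := G.C_pos hKne.some
  set S := extremalExt (combDist w) Y K with hS
  obtain ⟨D, hD⟩ : ∃ D : ℝ, ∀ a b : K, combDist w a b ≤ D := by
    obtain ⟨D, hD⟩ := (Set.finite_range fun p : K × K => combDist w p.1 p.2).bddAbove
    exact ⟨D, fun a b => hD ⟨(a, b), rfl⟩⟩
  have hsmall : ∀ η : ℝ, 0 < η → ∃ g ∈ lipOn (combDist w) K, (∀ k, |g k| ≤ D) ∧
      ∀ k : K, (2 * C)⁻¹ * lap w m (S g) k = η * g k := by
    intro η hη
    obtain ⟨g, hg, hlap⟩ := exists_lap_eq_smul hP G hcurv hη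
    refine ⟨g, hg, fun k => ?_, hlap⟩
    obtain ⟨a, ha, ha0⟩ := (isSideFunction_extremalExt hP G hg).exists_lap_nonneg G hcurv hKne
      hP.2.2.2.2.2.2.2
    obtain ⟨b, hb, hb0⟩ := (isSideFunction_neg_extremalExt hP G hg).exists_lap_nonneg G hcurv hKne
      hP.2.2.2.2.2.2.1
    rw [BoundedGeometry.lap_neg] at hb0
    have hga : 0 ≤ g ⟨a, ha⟩ := by
      have h1 := hlap ⟨a, ha⟩
      have h2 : 0 ≤ (2 * C)⁻¹ * lap w m (S g) a := mul_nonneg (by positivity) ha0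
      exact nonneg_of_mul_nonneg_right (h1 ▸ h2) hη
    have hgb : g ⟨b, hb⟩ ≤ 0 := by
      have h1 := hlap ⟨b, hb⟩
      have h2 : (2 * C)⁻¹ * lap w m (S g) b ≤ 0 :=
        mul_nonpos_of_nonneg_of_nonpos (by positivity) (by linarith)
      by_contra! h3
      have h4 : 0 < η * g ⟨b, hb⟩ := by positivity
      simp only at h1
      linarith
    rw [abs_le]
    constructor
    · linarith [hg k ⟨a, ha⟩, hD k ⟨a, ha⟩]
    · linarith [hg ⟨b, hb⟩ k, hD ⟨b, hb⟩ k]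
  set Q : Set (K → ℝ) := Set.Icc (fun _ => -D) (fun _ => D) ∩ lipOn (combDist w) K with hQ
  have hQc : IsCompact Q := isCompact_Icc.inter_right (isClosed_lipOn _ K)
  have hmem : ∀ g ∈ lipOn (combDist w) K, (∀ k, |g k| ≤ D) → g ∈ Q := fun g hg hgD =>
    ⟨⟨fun k => (abs_le.1 (hgD k)).1, fun k => (abs_le.1 (hgD k)).2⟩, hg⟩
  have hcont : Continuous fun g : K → ℝ => ∑ k : K, |lap w m (S g) k| := by
    refine continuous_finsetSum _ fun k _ => continuous_abs.comp ?_
    have hone : ∀ g g' : K → ℝ, lap w m (S g) k - lap w m (S g') k ≤ 2 * C * dist g g' := by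
      intro g g'
      have h1 : ∀ v, S g v - S g' v ≤ dist g g' := extremalExt_sub_le fun k =>
        (le_abs_self _).trans (dist_le_pi_dist g g' k)
      have h2 : ∀ v, S g' v - S g v ≤ dist g g' := extremalExt_sub_le fun k => by
        rw [dist_comm]
        exact (le_abs_self _).trans (dist_le_pi_dist g' g k)
      have h3 := G.lap_sub_lap_le (f := S g) (f' := S g') (x := k) (δ := 2 * dist g g')
        (by positivity) (fun z _ => by linarith [h1 z, h2 k])
      linarith
    refine LipschitzWith.continuous (K := ⟨2 * C, by positivity⟩)
      (LipschitzWith.of_dist_le_mul fun g g' => ?_)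
    rw [Real.dist_eq, abs_sub_le_iff]
    refine ⟨hone g g', ?_⟩
    rw [dist_comm]
    exact hone g' g
  obtain ⟨g₁, hg₁, hg₁D, -⟩ := hsmall 1 one_pos
  obtain ⟨g, hgQ, hmin⟩ := hQc.exists_isMinOn ⟨g₁, hmem g₁ hg₁ hg₁D⟩ hcont.continuousOn
  have hle : ∀ η : ℝ, 0 < η → ∑ k : K, |lap w m (S g) k| ≤ η * (∑ _k : K, 2 * C * D) := by
    intro η hη
    obtain ⟨g', hg', hg'D, hlap⟩ := hsmall η hη
    refine (hmin (hmem g' hg' hg'D)).trans ?_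
    rw [Finset.mul_sum]
    refine Finset.sum_le_sum fun k _ => ?_
    have h1 := hlap k
    rw [inv_mul_eq_iff_eq_mul₀ (by positivity)] at h1
    rw [h1, abs_mul, abs_of_pos (by positivity : 0 < 2 * C), abs_mul, abs_of_pos hη]
    calc 2 * C * (η * |g' k|) ≤ 2 * C * (η * D) := by gcongr; exact hg'D k
      _ = _ := by ring
  have hzero : ∑ k : K, |lap w m (S g) k| ≤ 0 := by
    set A := ∑ _k : K, 2 * C * D
    refine ge_of_tendsto (f := fun η : ℝ => η * A) (x := nhdsWithin 0 (Set.Ioi 0)) ?_ ?_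
    · have : Tendsto (fun η : ℝ => η * A) (nhds 0) (nhds (0 * A)) :=
        (continuous_id.mul continuous_const).tendsto 0
      rw [zero_mul] at this
      exact this.mono_left nhdsWithin_le_nhds
    · filter_upwards [self_mem_nhdsWithin] with η hη using hle η hη
  refine ⟨g, hgQ.2, fun k hk => ?_⟩
  have h1 := Finset.single_le_sum (f := fun k : K => |lap w m (S g) k|)
    (fun k _ => abs_nonneg _) (Finset.mem_univ (⟨k, hk⟩ : K))
  exact abs_eq_zero.1 (le_antisymm (h1.trans hzero) (abs_nonneg _))

end ExtremalExt

/-- Uniformly linear volume growth of a salami with bounded geometry. -/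
lemma exists_card_ball_le {w : V → V → ℝ} {m : V → ℝ} {c C : ℝ} {X Y K : Set V}
    (hP : SalamiPartition w m X Y K) (G : BoundedGeometry w m c C)
    (hcurv : NonnegCurv w m (combDist w)) :
    ∃ A : ℝ, 0 ≤ A ∧ ∀ (x₀ : V) (k : ℕ), 1 ≤ k → ∀ F : Finset V,
      (∀ y ∈ F, combDist w x₀ y ≤ 2 * k) → (F.card : ℝ) ≤ A * k := by
  classical
  have hKfin : K.Finite := hP.2.2.2.2.1
  have : Finite K := hKfin
  have : Nonempty K := (hP.nonempty G.conn).to_subtype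
  obtain ⟨g, hg, hlap⟩ := exists_lap_eq_zero hP G hcurv
  obtain ⟨N₁, hN₁, h₁⟩ := (isSideFunction_extremalExt hP G hg).exists_card_le_mul G hcurv
    (fun k hk => (hlap k hk).le)
  obtain ⟨N₂, hN₂, h₂⟩ := (isSideFunction_neg_extremalExt hP G hg).exists_card_le_mul G hcurv
    (fun k hk => by rw [BoundedGeometry.lap_neg, hlap k hk, neg_zero])
  refine ⟨N₁ + N₂ + hKfin.toFinset.card, by positivity, fun x₀ k hk F hF => ?_⟩
  have hcover : F ⊆ F.filter (· ∈ Y) ∪ F.filter (· ∈ X) ∪ hKfin.toFinset := by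
    intro y hy
    simp only [Finset.mem_union, Finset.mem_filter, hy, true_and, Set.Finite.mem_toFinset]
    by_cases hyX : y ∈ X
    · exact Or.inl (Or.inr hyX)
    by_cases hyK : y ∈ K
    · exact Or.inr hyK
    exact Or.inl (Or.inl (hP.mem_right hyX hyK))
  have hcard : F.card ≤ (F.filter (· ∈ Y)).card + (F.filter (· ∈ X)).card +
      hKfin.toFinset.card :=
    (Finset.card_le_card hcover).trans ((Finset.card_union_le _ _).trans
      (by gcongr; exact Finset.card_union_le _ _))
  have hcard' : (F.card : ℝ) ≤ (F.filter (· ∈ Y)).card + (F.filter (· ∈ X)).card +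
      hKfin.toFinset.card := by exact_mod_cast hcard
  have hY := h₁ x₀ k hk (F.filter (· ∈ Y)) (fun y hy =>
    have h := Finset.mem_filter.1 hy
    ⟨h.2, hF y h.1⟩)
  have hX := h₂ x₀ k hk (F.filter (· ∈ X)) (fun y hy =>
    have h := Finset.mem_filter.1 hy
    ⟨h.2, hF y h.1⟩)
  have hk1 : (1 : ℝ) ≤ k := by exact_mod_cast hk
  have hKk : (hKfin.toFinset.card : ℝ) ≤ hKfin.toFinset.card * k :=
    le_mul_of_one_le_right (by positivity) hk1
  linarith

/-- **Theorem (Cheng–Yau gradient estimate).** On a salami with combinatorial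
distance and bounded geometry there is a constant `C'` such that every function
positive and harmonic on a ball `B_R(x₀)` (`R ≥ 1`) satisfies
`|∇u|(x₀) ≤ (C'/R) u(x₀)`. -/
theorem salami_cheng_yau {V : Type*} (w : V → V → ℝ) (m : V → ℝ)
    (hS : IsSalami w m (combDist w))
    (c C : ℝ) (hc : 0 < c) (hcC : c < C)
    (hm : ∀ x, c < m x ∧ m x < C)
    (hwB : ∀ x y, 0 < w x y → c < w x y ∧ w x y < C)
    (hdeg : ∀ x, deg w m x < C) :
    ∃ C' : ℝ, ∀ (x₀ : V) (R : ℝ), 1 ≤ R → ∀ u : V → ℝ,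
      (∀ y, combDist w x₀ y ≤ R → 0 < u y) →
      (∀ y, combDist w x₀ y ≤ R → lap w m u y = 0) →
      gradAbs w (combDist w) u x₀ ≤ (C' / R) * u x₀ := by
  obtain ⟨⟨-, hsymm, hnonneg, hdiag, -, hlf, hconn, hmet, hballs⟩, hcurv, X, Y, K, hP⟩ := hS
  have G : BoundedGeometry w m c C :=
    { symm := hsymm
      nonneg := hnonneg
      diag := hdiag
      locFin := hlf
      conn := hconn
      metric := hmet
      balls := hballs
      c_pos := hc
      c_lt_m := fun x => (hm x).1
      m_lt_C := fun x => (hm x).2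
      c_lt_w := fun x y h => (hwB x y h).1
      deg_lt := hdeg }
  obtain ⟨A, hA, hvol⟩ := exists_card_ball_le hP G hcurv
  set M := A * C ^ 2 * Real.exp (2 * √(A * C ^ 2 / c)) / c with hM
  have hM0 : 0 ≤ M := by positivity
  set L := C ^ 2 / c + 1 with hL
  have hL0 : 0 ≤ L := by positivity
  refine ⟨2 * L + 4 * M, fun x₀ R hR u hpos hharm => ?_⟩
  have hR0 : 0 < R := by linarith
  have hu₀ : 0 < u x₀ := hpos x₀ (by rw [G.dist_self]; exact hR0.le)
  refine Real.sSup_le ?_ (by positivity)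
  rintro _ ⟨y, hy, rfl⟩
  rw [G.dist_eq_one hy, div_one, div_mul_eq_mul_div, le_div_iff₀ hR0]
  rcases lt_or_ge R 2 with hR2 | hR2
  · have h1 := G.abs_sub_le_of_unit_ball hy (fun z hz => hpos z (hz.trans hR))
      (hharm x₀ (by rw [G.dist_self]; exact hR0.le))
    calc |u y - u x₀| * R ≤ (L * u x₀) * 2 := by gcongr
      _ ≤ (2 * L + 4 * M) * u x₀ := by nlinarith [mul_nonneg hM0 hu₀.le]
  · set k := ⌊R / 2⌋₊ with hk
    have hk1 : 1 ≤ k := Nat.le_floor (by push_cast; linarith)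
    have hkR : 2 * (k : ℝ) ≤ R := by
      have := Nat.floor_le (show 0 ≤ R / 2 by positivity)
      linarith
    have hRk : R ≤ 4 * k := by
      have h1 := Nat.lt_floor_add_one (R / 2)
      have h2 : (1 : ℝ) ≤ k := by exact_mod_cast hk1
      rw [← hk] at h1
      linarith
    have h1 := G.abs_sub_le_of_linear_volume hy hk1 (fun z hz => hpos z (hz.trans hkR))
      (fun z hz => hharm z (hz.trans hkR)) (hvol x₀ k hk1)
    calc |u y - u x₀| * R ≤ |u y - u x₀| * (4 * k) := by gcongr
      _ = 4 * (k * |u y - u x₀|) := by ring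
      _ ≤ 4 * (M * u x₀) := by gcongr
      _ ≤ (2 * L + 4 * M) * u x₀ := by nlinarith [mul_nonneg hL0 hu₀.le]

end SalamiPaper
end

section
/- Let G=(V,w,m,d) be a salami with connected salami partition P=(X,Y,K). Then (1) there exists f ∈ ℱ(P) minimizing max_{x∈K} Δf(x) over ℱ(P), and (2) every such minimizer f satisfies Δf = const on K, i.e. Δf(x) = Δf(y) for all x,y ∈ K. -/
open Filter

namespace SalamiPaper

variable {V : Type*}

section FiniteExtrema

variable {K : Set V}

theorem sSup_eq_sup' (hK : K.Finite) (hne : hK.toFinset.Nonempty) (h : V → ℝ) :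
    sSup {c | ∃ u ∈ K, c = h u} = hK.toFinset.sup' hne h := by
  rw [Finset.sup'_eq_csSup_image]
  congr 1
  ext c
  simp [eq_comm]

theorem sInf_eq_inf' (hK : K.Finite) (hne : hK.toFinset.Nonempty) (h : V → ℝ) :
    sInf {c | ∃ u ∈ K, c = h u} = hK.toFinset.inf' hne h := by
  rw [Finset.inf'_eq_csInf_image]
  congr 1
  ext c
  simp [eq_comm]

end FiniteExtrema

section Laplacian

variable {w : V → V → ℝ} {m : V → ℝ}

theorem lap_eq_sum (hnn : ∀ x y, 0 ≤ w x y) (hlf : LocallyFinite w) (f : V → ℝ) (x : V) :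
    lap w m f x = (m x)⁻¹ * ∑ y ∈ (hlf x).toFinset, w x y * (f y - f x) := by
  unfold lap
  congr 1
  refine finsum_eq_sum_of_support_subset _ fun y hy => ?_
  have hxy : w x y ≠ 0 := left_ne_zero_of_mul hy
  simpa using lt_of_le_of_ne (hnn x y) hxy.symm

theorem lap_sub_const (f : V → ℝ) (c : ℝ) (x : V) :
    lap w m (fun v => f v - c) x = lap w m f x := by
  simp [lap]

theorem continuous_lap (hnn : ∀ x y, 0 ≤ w x y) (hlf : LocallyFinite w) (x : V) :
    Continuous fun f : V → ℝ => lap w m f x := by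
  simp only [lap_eq_sum hnn hlf]
  fun_prop

theorem lap_le_lap_of_touching (hnn : ∀ x y, 0 ≤ w x y) (hm : ∀ x, 0 < m x)
    (hlf : LocallyFinite w) {f g : V → ℝ} {c : ℝ} {x : V} (hle : ∀ v, g v ≤ f v + c)
    (hx : g x = f x + c) : lap w m g x ≤ lap w m f x := by
  rw [lap_eq_sum hnn hlf, lap_eq_sum hnn hlf]
  refine mul_le_mul_of_nonneg_left (Finset.sum_le_sum fun y _ => ?_) (inv_pos.2 (hm x)).le
  exact mul_le_mul_of_nonneg_left (by linarith [hle y]) (hnn x y)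

theorem lap_lt_lap_of_touching (hnn : ∀ x y, 0 ≤ w x y) (hm : ∀ x, 0 < m x)
    (hlf : LocallyFinite w) {f g : V → ℝ} {c : ℝ} {x z : V} (hle : ∀ v, g v ≤ f v + c)
    (hx : g x = f x + c) (hxz : 0 < w x z) (hz : g z < f z + c) :
    lap w m g x < lap w m f x := by
  rw [lap_eq_sum hnn hlf, lap_eq_sum hnn hlf]
  refine mul_lt_mul_of_pos_left (Finset.sum_lt_sum (fun y _ => ?_) ⟨z, by simpa, ?_⟩)
    (inv_pos.2 (hm x))
  · exact mul_le_mul_of_nonneg_left (by linarith [hle y]) (hnn x y)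
  · exact mul_lt_mul_of_pos_left (by linarith) hxz

end Laplacian

section PathMetric

variable {w : V → V → ℝ} {m : V → ℝ} {d : V → V → ℝ}

theorem Lip1.abs_sub_le (hd : IsPathMetric w d) {f : V → ℝ} (hf : Lip1 d f) (x y : V) :
    |f y - f x| ≤ d x y :=
  abs_sub_le_iff.2 ⟨hf x y, (hf y x).trans_eq (hd.2.2.1 y x)⟩

/-- The `d`-length of a path is at least the distance of its endpoints. -/
theorem dist_le_sum (hd : IsPathMetric w d) (p : ℕ → V) (n : ℕ) :
    d (p 0) (p n) ≤ ∑ i ∈ Finset.range n, d (p i) (p (i + 1)) := by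
  induction n with
  | zero => simp [hd.1]
  | succ n ih =>
    rw [Finset.sum_range_succ]
    linarith [hd.2.2.2.1 (p 0) (p n) (p (n + 1))]

/-- On a locally finite graph some neighbor of `x` is the start of a geodesic to `y`. -/
theorem exists_adj_dist_add_eq (hd : IsPathMetric w d) (hlf : LocallyFinite w) {x y : V}
    (hxy : x ≠ y) : ∃ z, 0 < w x z ∧ d x z + d z y = d x y := by
  obtain ⟨-, hpos, -, htri, hinf⟩ := id hd
  have hne : (pathLens w d x y).Nonempty := by
    by_contra h
    rw [Set.not_nonempty_iff_eq_empty] at h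
    have := hpos x y hxy
    rw [hinf, h, Real.sInf_empty] at this
    exact this.false
  have hfirst : ∀ L ∈ pathLens w d x y, ∃ z, 0 < w x z ∧ d x z + d z y ≤ L := by
    rintro L ⟨n, p, rfl, rfl, hp, rfl⟩
    cases n with
    | zero => exact absurd rfl hxy
    | succ n =>
      refine ⟨p 1, hp 0 n.succ_pos, ?_⟩
      rw [Finset.sum_range_succ']
      have := dist_le_sum hd (fun i => p (i + 1)) n
      simp only [zero_add] at this ⊢
      linarith
  have hN : (hlf x).toFinset.Nonempty := by
    obtain ⟨L, hL⟩ := hne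
    obtain ⟨z, hz, -⟩ := hfirst L hL
    exact ⟨z, by simpa⟩
  obtain ⟨z, hz, hmin⟩ := Finset.exists_min_image _ (fun z => d x z + d z y) hN
  refine ⟨z, by simpa using hz, le_antisymm ?_ (htri x z y)⟩
  rw [hinf x y]
  refine le_csInf hne fun L hL => ?_
  obtain ⟨z', hz', hle⟩ := hfirst L hL
  exact (hmin z' (by simpa)).trans hle

/-- Induction along geodesics ending in `y`. -/
theorem geodesic_induction (hd : IsPathMetric w d) (hlf : LocallyFinite w) (hfin : FiniteBalls d)
    (hirr : ∀ x, w x x = 0) {y : V} {p : V → Prop} (hy : p y)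
    (hstep : ∀ x z, 0 < w x z → d x z + d z y = d x y → p z → p x) (x : V) : p x := by
  induction hn : {v | d y v ≤ d y x}.ncard using Nat.strong_induction_on generalizing x with
  | _ n ih =>
    by_cases hxy : x = y
    · rwa [hxy]
    obtain ⟨z, hxz, hz⟩ := exists_adj_dist_add_eq hd hlf hxy
    have hlt : d y z < d y x := by
      have hne : x ≠ z := by
        rintro rfl
        exact hxz.ne' (hirr x)
      have := hd.2.1 x z hne
      rw [hd.2.2.1 y z, hd.2.2.1 y x]
      linarith
    refine hstep x z hxz hz (ih _ ?_ z rfl)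
    rw [← hn]
    refine Set.ncard_lt_ncard ?_ (hfin y _)
    refine (Set.ssubset_iff_of_subset fun v hv => le_trans hv hlt.le).2 ⟨x, le_refl (d y x), not_le.2 hlt⟩

theorem abs_lap_le (hd : IsPathMetric w d) (hnn : ∀ x y, 0 ≤ w x y) (hm : ∀ x, 0 < m x)
    (hlf : LocallyFinite w) {f : V → ℝ} (hf : Lip1 d f) (x : V) :
    |lap w m f x| ≤ (m x)⁻¹ * ∑ y ∈ (hlf x).toFinset, w x y * d x y := by
  rw [lap_eq_sum hnn hlf, abs_mul, abs_of_pos (inv_pos.2 (hm x))]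
  refine mul_le_mul_of_nonneg_left ((Finset.abs_sum_le_sum_abs _ _).trans
    (Finset.sum_le_sum fun y _ => ?_)) (inv_pos.2 (hm x)).le
  rw [abs_mul, abs_of_nonneg (hnn x y)]
  exact mul_le_mul_of_nonneg_left (hf.abs_sub_le hd x y) (hnn x y)

/-- Nonnegative curvature: the Laplacian of a `1`-Lipschitz function decreases along each edge
on which the function grows with maximal slope. -/
theorem NonnegCurv.lap_le_of_adj (hG : IsGraphBase w m d) (hcurv : NonnegCurv w m d)
    {f : V → ℝ} (hf : Lip1 d f) {x y : V} (hxy : 0 < w x y) (h : f y - f x = d x y) :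
    lap w m f y ≤ lap w m f x := by
  obtain ⟨-, -, hnn, hirr, hm, hlf, -, hd, -⟩ := hG
  have hne : x ≠ y := by
    rintro rfl
    exact hxy.ne' (hirr x)
  have hinf := nonneg_of_mul_nonneg_right (hcurv x y hxy) (inv_pos.2 (hd.2.1 x y hne))
  refine sub_nonneg.1 (hinf.trans (csInf_le ?_ ⟨f, hf, h, rfl⟩))
  refine ⟨-((m x)⁻¹ * ∑ z ∈ (hlf x).toFinset, w x z * d x z)
    - (m y)⁻¹ * ∑ z ∈ (hlf y).toFinset, w y z * d y z, ?_⟩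
  rintro c ⟨g, hg, -, rfl⟩
  have hx := abs_le.1 (abs_lap_le hd hnn hm hlf hg x)
  have hy := abs_le.1 (abs_lap_le hd hnn hm hlf hg y)
  linarith [hx.1, hy.2]

/-- The Laplacian of a `1`-Lipschitz function decreases from `x` to `y` whenever the function
attains maximal growth between `x` and `y`, adjacent or not. -/
theorem NonnegCurv.lap_le (hG : IsGraphBase w m d) (hcurv : NonnegCurv w m d)
    {f : V → ℝ} (hf : Lip1 d f) {x y : V} (h : f y - f x = d x y) :
    lap w m f y ≤ lap w m f x := by
  obtain ⟨-, -, -, hirr, -, hlf, -, hd, hfin⟩ := id hG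
  refine geodesic_induction hd hlf hfin hirr (y := y)
    (p := fun x => f y - f x = d x y → lap w m f y ≤ lap w m f x) (fun _ => le_rfl) ?_ x h
  intro x z hxz hgeo ih h
  have h₁ := hf x z
  have h₂ := hf z y
  exact (ih (by linarith)).trans (hcurv.lap_le_of_adj hG hf hxz (by linarith))

end PathMetric

section Extension

variable {w : V → V → ℝ} {m : V → ℝ} {d : V → V → ℝ} {X Y K : Set V}

theorem Sop_of_mem {f : V → ℝ} {v : V} (hv : v ∈ K) : Sop d X Y K f v = f v := by
  simp [Sop, hv]

theorem Sop_congr {f g : V → ℝ} (h : ∀ v ∈ K, f v = g v) : Sop d X Y K f = Sop d X Y K g := by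
  funext v
  unfold Sop
  split_ifs with hv
  · exact h v hv
  · congr 1
    ext c
    exact exists_congr fun u => and_congr_right fun hu => by rw [h u hu]
  · congr 1
    ext c
    exact exists_congr fun u => and_congr_right fun hu => by rw [h u hu]

theorem Sop_eq_self_of_mem_calF {f : V → ℝ} (hf : f ∈ calF d X Y K) : Sop d X Y K f = f := by
  obtain ⟨f₀, -, rfl⟩ := hf
  exact Sop_congr fun _ hv => Sop_of_mem hv

theorem continuous_Sop (hK : K.Finite) (hne : K.Nonempty) : Continuous (Sop d X Y K) := by
  have hne' : hK.toFinset.Nonempty := by simpa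
  refine continuous_pi fun v => ?_
  by_cases hv : v ∈ K
  · simp only [Sop, if_pos hv]
    exact continuous_apply v
  by_cases hvX : v ∈ X
  · simp only [Sop, if_neg hv, if_pos hvX, sSup_eq_sup' hK hne' fun u => _ - d v u]
    exact Continuous.finset_sup'_apply _ fun u _ => by fun_prop
  · simp only [Sop, if_neg hv, if_neg hvX, sInf_eq_inf' hK hne' fun u => _ + d v u]
    exact Continuous.finset_inf'_apply _ fun u _ => by fun_prop

theorem SalamiPartition.mem_or (hP : SalamiPartition w m X Y K) (v : V) :
    v ∈ X ∨ v ∈ Y ∨ v ∈ K := by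
  have : v ∈ X ∪ Y ∪ K := hP.1 ▸ Set.mem_univ v
  simpa [or_assoc] using this

theorem SalamiPartition.notMem_or (hP : SalamiPartition w m X Y K) (v : V) :
    v ∉ Y ∨ v ∉ X := by
  by_contra! h
  exact Set.disjoint_left.1 hP.2.1 h.2 h.1

/-- Outside `Y` the extension is the greatest of the lower cones over `K`. -/
theorem Sop_isGreatest (hd : IsPathMetric w d) (hP : SalamiPartition w m X Y K)
    (hne : K.Nonempty) {f : V → ℝ} (hf : Lip1On d K f) {v : V} (hv : v ∉ Y) :
    IsGreatest ((fun u => f u - d v u) '' K) (Sop d X Y K f v) := by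
  by_cases hvK : v ∈ K
  · rw [Sop_of_mem hvK]
    refine ⟨⟨v, hvK, by simp [hd.1]⟩, ?_⟩
    rintro _ ⟨u, hu, rfl⟩
    linarith [hf v hvK u hu]
  have hK : K.Finite := hP.2.2.2.2.1
  have hvX : v ∈ X := by
    have := hP.mem_or v
    tauto
  have hS : Sop d X Y K f v = sSup ((fun u => f u - d v u) '' K) := by
    simp only [Sop, if_neg hvK, if_pos hvX]
    congr 1
    ext c
    simp [eq_comm]
  rw [hS]
  exact ⟨(hne.image _).csSup_mem (hK.image _), fun c hc => le_csSup (hK.image _).bddAbove hc⟩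

/-- Outside `X` the extension is the least of the upper cones over `K`. -/
theorem Sop_isLeast (hd : IsPathMetric w d) (hP : SalamiPartition w m X Y K)
    (hne : K.Nonempty) {f : V → ℝ} (hf : Lip1On d K f) {v : V} (hv : v ∉ X) :
    IsLeast ((fun u => f u + d v u) '' K) (Sop d X Y K f v) := by
  by_cases hvK : v ∈ K
  · rw [Sop_of_mem hvK]
    refine ⟨⟨v, hvK, by simp [hd.1]⟩, ?_⟩
    rintro _ ⟨u, hu, rfl⟩
    have := hd.2.2.1 u v
    linarith [hf u hu v hvK]
  have hK : K.Finite := hP.2.2.2.2.1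
  have hS : Sop d X Y K f v = sInf ((fun u => f u + d v u) '' K) := by
    simp only [Sop, if_neg hvK, if_neg hv]
    congr 1
    ext c
    simp [eq_comm]
  rw [hS]
  exact ⟨(hne.image _).csInf_mem (hK.image _), fun c hc => csInf_le (hK.image _).bddBelow hc⟩

theorem Sop_le_Sop_add (hd : IsPathMetric w d) (hP : SalamiPartition w m X Y K)
    (hne : K.Nonempty) {f g : V → ℝ} (hf : Lip1On d K f) (hg : Lip1On d K g) {c : ℝ}
    (hle : ∀ u ∈ K, f u ≤ g u + c) (v : V) : Sop d X Y K f v ≤ Sop d X Y K g v + c := by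
  rcases hP.notMem_or v with hv | hv
  · obtain ⟨u, hu, hfu⟩ := (Sop_isGreatest hd hP hne hf hv).1
    have := (Sop_isGreatest hd hP hne hg hv).2 ⟨u, hu, rfl⟩
    simp only at hfu this
    linarith [hle u hu]
  · obtain ⟨u, hu, hgu⟩ := (Sop_isLeast hd hP hne hg hv).1
    have := (Sop_isLeast hd hP hne hf hv).2 ⟨u, hu, rfl⟩
    simp only at hgu this
    linarith [hle u hu]

theorem Sop_sub_const (hd : IsPathMetric w d) (hP : SalamiPartition w m X Y K)
    (hne : K.Nonempty) {f : V → ℝ} (hf : Lip1On d K f) (c : ℝ) :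
    Sop d X Y K (fun v => f v - c) = fun v => Sop d X Y K f v - c := by
  have hf' : Lip1On d K fun v => f v - c := fun x hx y hy => by linarith [hf x hx y hy]
  funext v
  have h₁ := Sop_le_Sop_add (c := -c) hd hP hne hf' hf (fun u _ => by linarith) v
  have h₂ := Sop_le_Sop_add (c := c) hd hP hne hf hf' (fun u _ => by linarith) v
  linarith

/-- Some geodesic from `X ∪ K` to `Y ∪ K` meets `K`. -/
theorem SalamiPartition.exists_mem_dist_add_eq (hG : IsGraphBase w m d)
    (hP : SalamiPartition w m X Y K) {x y : V} (hx : x ∉ Y) (hy : y ∉ X) :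
    ∃ k ∈ K, d x k + d k y = d x y := by
  obtain ⟨-, -, -, hirr, -, hlf, -, hd, hfin⟩ := id hG
  refine geodesic_induction hd hlf hfin hirr (y := y)
    (p := fun x => x ∉ Y → ∃ k ∈ K, d x k + d k y = d x y) ?_ ?_ x hx
  · intro hyY
    have hyK := hP.mem_or y
    exact ⟨y, by tauto, by simp [hd.1]⟩
  · intro x z hxz hgeo ih hxY
    rcases hP.mem_or x with hxX | hxY' | hxK
    · have hzY : z ∉ Y := fun hz => hxz.ne' (hP.2.2.2.2.2.1 x hxX z hz)
      obtain ⟨k, hk, hkz⟩ := ih hzY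
      exact ⟨k, hk, le_antisymm (by linarith [hd.2.2.2.1 x z k]) (hd.2.2.2.1 x k y)⟩
    · exact absurd hxY' hxY
    · exact ⟨x, hxK, by simp [hd.1]⟩

theorem lip1_Sop (hG : IsGraphBase w m d) (hP : SalamiPartition w m X Y K)
    (hne : K.Nonempty) {f : V → ℝ} (hf : Lip1On d K f) : Lip1 d (Sop d X Y K f) := by
  have hd : IsPathMetric w d := hG.2.2.2.2.2.2.2.1
  obtain ⟨-, -, hsymm, htri, -⟩ := id hd
  intro x y
  rcases hP.notMem_or x with hx | hx <;> rcases hP.notMem_or y with hy | hy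
  · obtain ⟨u, hu, hu'⟩ := (Sop_isGreatest hd hP hne hf hy).1
    have := (Sop_isGreatest hd hP hne hf hx).2 ⟨u, hu, rfl⟩
    simp only at hu' this
    linarith [htri x y u]
  · obtain ⟨k, hk, hgeo⟩ := hP.exists_mem_dist_add_eq hG hx hy
    have h₁ := (Sop_isGreatest hd hP hne hf hx).2 ⟨k, hk, rfl⟩
    have h₂ := (Sop_isLeast hd hP hne hf hy).2 ⟨k, hk, rfl⟩
    simp only at h₁ h₂
    linarith [hsymm k y]
  · obtain ⟨u, hu, hu'⟩ := (Sop_isGreatest hd hP hne hf hy).1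
    obtain ⟨v, hv, hv'⟩ := (Sop_isLeast hd hP hne hf hx).1
    simp only at hu' hv'
    linarith [hf v hv u hu, htri v x u, htri x y u, hsymm v x]
  · obtain ⟨u, hu, hu'⟩ := (Sop_isLeast hd hP hne hf hx).1
    have := (Sop_isLeast hd hP hne hf hy).2 ⟨u, hu, rfl⟩
    simp only at hu' this
    linarith [htri y x u, hsymm x y]

theorem lip1_of_mem_calF (hG : IsGraphBase w m d) (hP : SalamiPartition w m X Y K)
    (hne : K.Nonempty) {f : V → ℝ} (hf : f ∈ calF d X Y K) : Lip1 d f := by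
  obtain ⟨f₀, hf₀, rfl⟩ := hf
  exact lip1_Sop hG hP hne hf₀

end Extension

section Variational

variable {w : V → V → ℝ} {m : V → ℝ} {d : V → V → ℝ} {X Y K : Set V}

theorem exists_minimizer (hG : IsGraphBase w m d) (hP : SalamiPartition w m X Y K)
    (hne : K.Nonempty) :
    ∃ f ∈ calF d X Y K, ∀ g ∈ calF d X Y K,
      sSup {c | ∃ x ∈ K, c = lap w m f x} ≤ sSup {c | ∃ x ∈ K, c = lap w m g x} := by
  obtain ⟨-, -, hnn, -, -, hlf, -, hd, -⟩ := id hG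
  have hK : K.Finite := hP.2.2.2.2.1
  have hne' : hK.toFinset.Nonempty := by simpa
  obtain ⟨o, -⟩ := id hne
  let T : Set (V → ℝ) :=
    Set.univ.pi (fun v => Set.Icc (-d o v) (d o v)) ∩ {f | Lip1 d f}
  have hT : IsCompact T := by
    refine (isCompact_univ_pi fun v => isCompact_Icc).inter_right ?_
    have : {f | Lip1 d f} = ⋂ (x) (y), {f : V → ℝ | f y - f x ≤ d x y} := by
      ext f
      simp [Lip1]
    rw [this]
    exact isClosed_iInter fun x => isClosed_iInter fun y =>
      isClosed_le (by fun_prop) continuous_const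
  have hsub : ∀ f : V → ℝ, Lip1 d f → (fun v => f v - f o) ∈ T := fun f hf =>
    ⟨fun v _ => abs_le.1 (hf.abs_sub_le hd o v), fun x y => by linarith [hf x y]⟩
  have hTne : T.Nonempty := by
    refine ⟨_, hsub (fun v => d o v) fun x y => ?_⟩
    linarith [hd.2.2.2.1 o x y]
  have hcont : Continuous fun f : V → ℝ =>
      sSup {c | ∃ x ∈ K, c = lap w m (Sop d X Y K f) x} := by
    simp only [sSup_eq_sup' hK hne' (lap w m _)]
    exact Continuous.finset_sup'_apply hne' fun x _ =>
      (continuous_lap hnn hlf x).comp (continuous_Sop hK hne)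
  obtain ⟨f, hfT, hmin⟩ := hT.exists_isMinOn hTne hcont.continuousOn
  refine ⟨_, ⟨f, fun x _ y _ => hfT.2 x y, rfl⟩, fun g hg => ?_⟩
  have hgLip := lip1_of_mem_calF hG hP hne hg
  have := hmin (hsub g hgLip)
  simpa only [Set.mem_ofPred_eq, Sop_sub_const hd hP hne (fun x _ y _ => hgLip x y),
    lap_sub_const, Sop_eq_self_of_mem_calF hg] using this

/-- A set `K` inducing a connected subgraph has an edge leaving any proper nonempty subset. -/
theorem ConnectedIn.exists_boundary_edge (hK : ConnectedIn w K) {p : V → Prop} {x z : V}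
    (hxK : x ∈ K) (hzK : z ∈ K) (hx : p x) (hz : ¬ p z) :
    ∃ a ∈ K, ∃ b ∈ K, 0 < w a b ∧ p a ∧ ¬ p b := by
  by_contra! h
  refine hz ?_
  have := hK x hxK z hzK
  clear hz hzK
  induction this with
  | refl => exact hx
  | tail _ hab ih => exact h _ hab.1 _ hab.2.1 hab.2.2 ih

/-- For small `ε > 0` the explicit heat step `f + ε Δf` stays `1`-Lipschitz on `K`. -/
theorem eventually_lip1On_add_mul_lap (hG : IsGraphBase w m d) (hcurv : NonnegCurv w m d)
    (hK : K.Finite) {f : V → ℝ} (hf : Lip1 d f) :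
    ∀ᶠ ε in nhdsWithin (0 : ℝ) (Set.Ioi 0), Lip1On d K fun v => f v + ε * lap w m f v := by
  simp only [Lip1On, Filter.eventually_all_finite hK]
  intro x _ y _
  rcases (hf x y).eq_or_lt with h | h
  · have hle := hcurv.lap_le hG hf h
    filter_upwards [self_mem_nhdsWithin] with ε hε
    linarith [mul_le_mul_of_nonneg_left hle (le_of_lt hε)]
  · have hc : Continuous fun ε : ℝ =>
        f y + ε * lap w m f y - (f x + ε * lap w m f x) := by fun_prop
    have := (hc.tendsto 0).eventually_lt_const (u := d x y) (by simpa using h)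
    exact (this.filter_mono nhdsWithin_le_nhds).mono fun _ => le_of_lt

/-- If `Δf ≤ C` on `K` and this is not an equality everywhere, then some element of `calF` has
Laplacian strictly below `C` on all of `K`. -/
theorem exists_lap_lt (hG : IsGraphBase w m d) (hcurv : NonnegCurv w m d)
    (hP : ConnectedSalamiPartition w m X Y K) {C : ℝ} {f : V → ℝ} (hf : f ∈ calF d X Y K)
    (hle : ∀ x ∈ K, lap w m f x ≤ C) {z : V} (hzK : z ∈ K) (hz : lap w m f z < C) :
    ∃ g ∈ calF d X Y K, ∀ x ∈ K, lap w m g x < C := by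
  obtain ⟨-, -, hnn, -, hm, hlf, -, hd, -⟩ := id hG
  have hK : K.Finite := hP.1.2.2.2.2.1
  have hne : K.Nonempty := ⟨z, hzK⟩
  induction hn : {x ∈ K | lap w m f x = C}.ncard using Nat.strong_induction_on
    generalizing f with
  | _ n ih =>
    by_cases hM : ∃ x ∈ K, lap w m f x = C
    swap
    · push Not at hM
      exact ⟨f, hf, fun x hx => lt_of_le_of_ne (hle x hx) (hM x hx)⟩
    obtain ⟨x, hxK, hx⟩ := hM
    obtain ⟨a, haK, b, hbK, hab, ha, hb⟩ :=
      hP.2.exists_boundary_edge (p := fun v => lap w m f v = C) hxK hzK hx hz.ne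
    have hfLip := lip1_of_mem_calF hG hP.1 hne hf
    have hstay : ∀ᶠ ε in nhdsWithin (0 : ℝ) (Set.Ioi 0), ∀ v ∈ K, lap w m f v < C →
        lap w m (Sop d X Y K fun u => f u + ε * lap w m f u) v < C := by
      rw [Filter.eventually_all_finite hK]
      intro v _
      by_cases hv : lap w m f v < C
      swap
      · exact Filter.Eventually.of_forall fun _ h => absurd h hv
      have hc : Continuous fun ε : ℝ =>
          lap w m (Sop d X Y K fun u => f u + ε * lap w m f u) v :=
        (continuous_lap hnn hlf v).comp ((continuous_Sop hK hne).comp (by fun_prop))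
      have := (hc.tendsto 0).eventually_lt_const (u := C)
        (by simpa [Sop_eq_self_of_mem_calF hf] using hv)
      exact (this.filter_mono nhdsWithin_le_nhds).mono fun _ h _ => h
    obtain ⟨ε, hLip, hε, hpos⟩ := ((eventually_lip1On_add_mul_lap hG hcurv hK hfLip).and
      (hstay.and self_mem_nhdsWithin)).exists
    set g := Sop d X Y K fun u => f u + ε * lap w m f u with hg
    have hgK : ∀ v ∈ K, g v = f v + ε * lap w m f v := fun v hv => Sop_of_mem hv
    have hgle : ∀ v, g v ≤ f v + ε * C := by
      have := Sop_le_Sop_add (c := ε * C) hd hP.1 hne hLip (fun x _ y _ => hfLip x y)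
        fun u hu => by gcongr; exact hle u hu
      rwa [Sop_eq_self_of_mem_calF hf] at this
    have hlapa : lap w m g a < C := by
      refine (lap_lt_lap_of_touching hnn hm hlf hgle (by rw [hgK a haK, ha]) hab ?_).trans_eq ha
      rw [hgK b hbK]
      gcongr
      exact lt_of_le_of_ne (hle b hbK) hb
    have hlap : ∀ v ∈ K, lap w m f v = C → lap w m g v ≤ C := fun v hv h =>
      (lap_le_lap_of_touching hnn hm hlf hgle (by rw [hgK v hv, h])).trans_eq h
    refine ih _ ?_ ⟨_, hLip, hg⟩ (fun v hv => ?_) (hε z hzK hz) rfl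
    · rw [← hn]
      refine Set.ncard_lt_ncard ((Set.ssubset_iff_of_subset ?_).2 ⟨a, ⟨haK, ha⟩, ?_⟩)
        (hK.subset (Set.sep_subset _ _))
      · rintro v ⟨hv, hgv⟩
        refine ⟨hv, (hle v hv).eq_of_not_lt fun h => ?_⟩
        exact (hε v hv h).ne hgv
      · exact fun h => hlapa.ne h.2
    · rcases (hle v hv).eq_or_lt with h | h
      · exact hlap v hv h
      · exact (hε v hv h).le

end Variational

/-- **Lemma (Variational principle).** On a salami with connected salami
partition `P = (X,Y,K)`: (1) there is a minimizer `f ∈ ℱ(P)` of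
`max_K Δf`, and (2) every such minimizer satisfies `Δf = const` on `K`. -/
theorem variational_principle {V : Type*} (w : V → V → ℝ) (m : V → ℝ)
    (d : V → V → ℝ) (hS : IsSalami w m d) (X Y K : Set V)
    (hP : ConnectedSalamiPartition w m X Y K) :
    (∃ f ∈ calF d X Y K, ∀ g ∈ calF d X Y K,
        sSup {c | ∃ x ∈ K, c = lap w m f x} ≤
          sSup {c | ∃ x ∈ K, c = lap w m g x}) ∧
    (∀ f ∈ calF d X Y K,
      (∀ g ∈ calF d X Y K,
        sSup {c | ∃ x ∈ K, c = lap w m f x} ≤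
          sSup {c | ∃ x ∈ K, c = lap w m g x}) →
      ∀ x ∈ K, ∀ y ∈ K, lap w m f x = lap w m f y) := by
  obtain ⟨hG, hcurv, -⟩ := hS
  have hK : K.Finite := hP.1.2.2.2.2.1
  rcases K.eq_empty_or_nonempty with rfl | hne
  · exact ⟨⟨_, ⟨fun _ => 0, by simp [Lip1On], rfl⟩, by simp⟩, by simp⟩
  refine ⟨exists_minimizer hG hP.1 hne, fun f hf hmin => ?_⟩
  have hne' : hK.toFinset.Nonempty := by simpa
  simp only [sSup_eq_sup' hK hne' (lap w m _)] at hmin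
  set C := hK.toFinset.sup' hne' (lap w m f)
  have hle : ∀ x ∈ K, lap w m f x ≤ C := fun x hx => Finset.le_sup' _ (by simpa)
  have heq : ∀ x ∈ K, lap w m f x = C := by
    intro z hz
    by_contra hzC
    obtain ⟨g, hg, hlt⟩ := exists_lap_lt hG hcurv hP hf hle hz (lt_of_le_of_ne (hle z hz) hzC)
    refine (hmin g hg).not_gt ?_
    rw [Finset.sup'_lt_iff]
    exact fun x hx => hlt x (by simpa using hx)
  intro x hx y hy
  rw [heq x hx, heq y hy]

end SalamiPaper
end
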